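/- For each p ∈ (1, ∞) there exists a constant C_p > 0 such that for every continuously differentiable f : ℂ → ℂ with compact support contained in the open unit disk D one has ‖∂(Pf)‖_{L^p(D)} ≤ C_p ‖f‖_{L^p(D)}. (Boundedness of the operator T = ∂ ∘ P on L^p, parts 3 and 6 of Theorem 2.1.) -/

import Mathlib

open MeasureTheory

/-- The Cauchy–Green operator on the unit disk. -/
noncomputable def cauchyGreen (f : ℂ → ℂ) (z : ℂ) : ℂ :=
  -(1 / (Real.pi : ℂ)) * ∫ w in Metric.ball (0 : ℂ) 1, f w / (w - z)

/-- The operator `∂g = ½(∂g/∂x − i ∂g/∂y)`. -/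
noncomputable def dop (g : ℂ → ℂ) (z : ℂ) : ℂ :=
  (1 / 2 : ℂ) * (fderiv ℝ g z 1 - Complex.I * fderiv ℝ g z Complex.I)

open scoped ENNReal

/-- The real-linear map `e ↦ a e + b ē`, the real derivative of a function with Wirtinger
derivatives `a` and `b`. -/
noncomputable def wirtinger (a b : ℂ) : ℂ →L[ℝ] ℂ :=
  ContinuousLinearMap.mul ℝ ℂ a +
    (ContinuousLinearMap.mul ℝ ℂ b).comp Complex.conjCLE.toContinuousLinearMap

@[simp] lemma wirtinger_apply (a b e : ℂ) :
    wirtinger a b e = a * e + b * (starRingEnd ℂ) e := by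
  simp [wirtinger]

lemma hasFDerivAt_wirtinger_mul {F G : ℂ → ℂ} {a b c d z : ℂ}
    (hF : HasFDerivAt F (wirtinger a b) z) (hG : HasFDerivAt G (wirtinger c d) z) :
    HasFDerivAt (fun x => F x * G x) (wirtinger (F z * c + a * G z) (F z * d + b * G z)) z := by
  refine (hF.mul hG).congr_fderiv ?_
  ext e
  simp
  ring

lemma hasFDerivAt_wirtinger_conj {F : ℂ → ℂ} {a b z : ℂ}
    (hF : HasFDerivAt F (wirtinger a b) z) :
    HasFDerivAt (fun x => (starRingEnd ℂ) (F x))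
      (wirtinger ((starRingEnd ℂ) b) ((starRingEnd ℂ) a)) z := by
  refine (Complex.conjCLE.toContinuousLinearMap.hasFDerivAt.comp z hF).congr_fderiv ?_
  ext e
  simp
  ring

lemma hasFDerivAt_wirtinger_id (z : ℂ) : HasFDerivAt (fun x : ℂ => x) (wirtinger 1 0) z := by
  refine (hasFDerivAt_id z).congr_fderiv ?_
  ext e
  simp

lemma hasFDerivAt_wirtinger_comp_sub {F : ℂ → ℂ} {a b z : ℂ} (w : ℂ)
    (hF : HasFDerivAt F (wirtinger a b) (z - w)) :
    HasFDerivAt (fun x => F (x - w)) (wirtinger a b) z := by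
  exact hF.comp z ((hasFDerivAt_id z).sub_const w)

lemma hasFDerivAt_wirtinger_inv {F : ℂ → ℂ} {a b z : ℂ}
    (hF : HasFDerivAt F (wirtinger a b) z) (h0 : F z ≠ 0) :
    HasFDerivAt (fun x => (F x)⁻¹)
      (wirtinger (-a / F z ^ 2) (-b / F z ^ 2)) z := by
  have h := ((hasFDerivAt_inv (𝕜 := ℂ) h0).restrictScalars ℝ).comp z hF
  refine h.congr_fderiv ?_
  ext e
  simp
  ring

lemma integral_wirtinger_eq_zero {F a b : ℂ → ℂ}
    (hF : ∀ z, HasFDerivAt F (wirtinger (a z) (b z)) z) (hFi : Integrable F)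
    (ha : Integrable a) (hb : Integrable b) : ∫ z, a z = 0 ∧ ∫ z, b z = 0 := by
  have key : ∀ e : ℂ, (∫ z, a z) * e + (∫ z, b z) * (starRingEnd ℂ) e = 0 := by
    intro e
    have h := integral_bilinear_hasLineDerivAt_right_eq_neg_left_of_integrable (μ := volume)
      (f := F) (f' := fun z => a z * e + b z * (starRingEnd ℂ) e) (g := fun _ => (1 : ℂ))
      (g' := fun _ => 0) (v := e) (B := ContinuousLinearMap.mul ℝ ℂ)
      (by
        simp only [ContinuousLinearMap.mul_apply', mul_one]
        exact (ha.mul_const _).add (hb.mul_const _))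
      (by simp)
      (by simpa using hFi)
      (fun z _ => by simpa using (hF z).hasLineDerivAt e)
      (fun z _ => by simpa using (hasFDerivAt_const (1 : ℂ) z).hasLineDerivAt e)
    simp only [ContinuousLinearMap.mul_apply', mul_zero, integral_zero, mul_one] at h
    rw [integral_add (ha.mul_const _) (hb.mul_const _), integral_mul_const,
      integral_mul_const] at h
    exact neg_eq_zero.mp h.symm
  have h1 := key 1
  have h2 := key Complex.I
  simp only [map_one, mul_one, Complex.conj_I] at h1 h2
  have h3 : (∫ z, a z) - ∫ z, b z = 0 := by
    have : Complex.I * ((∫ z, a z) - ∫ z, b z) = 0 := by linear_combination h2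
    exact (mul_eq_zero.mp this).resolve_left Complex.I_ne_zero
  exact ⟨by linear_combination (h1 + h3) / 2, by linear_combination (h1 - h3) / 2⟩

/-- `F z = O((1 + |z|)⁻ᵏ)` on the whole plane. -/
def HasDecay (k : ℕ) (F : ℂ → ℂ) : Prop :=
  ∃ c : ℝ, ∀ z, ‖F z‖ ≤ c * ((1 + ‖z‖)⁻¹) ^ k

lemma HasDecay.mul {k l : ℕ} {F G : ℂ → ℂ} (hF : HasDecay k F) (hG : HasDecay l G) :
    HasDecay (k + l) (fun z => F z * G z) := by
  obtain ⟨c, hc⟩ := hF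
  obtain ⟨d, hd⟩ := hG
  refine ⟨c * d, fun z => ?_⟩
  rw [norm_mul, pow_add]
  calc ‖F z‖ * ‖G z‖ ≤ (c * ((1 + ‖z‖)⁻¹) ^ k) * (d * ((1 + ‖z‖)⁻¹) ^ l) :=
        mul_le_mul (hc z) (hd z) (norm_nonneg _) ((norm_nonneg _).trans (hc z))
    _ = _ := by ring

lemma HasDecay.const_mul {k : ℕ} {F : ℂ → ℂ} (hF : HasDecay k F) (a : ℂ) :
    HasDecay k (fun z => a * F z) := by
  obtain ⟨c, hc⟩ := hF
  refine ⟨‖a‖ * c, fun z => ?_⟩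
  rw [norm_mul, mul_assoc]
  exact mul_le_mul_of_nonneg_left (hc z) (norm_nonneg _)

lemma HasDecay.add {k : ℕ} {F G : ℂ → ℂ} (hF : HasDecay k F) (hG : HasDecay k G) :
    HasDecay k (fun z => F z + G z) := by
  obtain ⟨c, hc⟩ := hF
  obtain ⟨d, hd⟩ := hG
  refine ⟨c + d, fun z => ?_⟩
  rw [add_mul]
  exact (norm_add_le _ _).trans (add_le_add (hc z) (hd z))

lemma HasDecay.conj {k : ℕ} {F : ℂ → ℂ} (hF : HasDecay k F) :
    HasDecay k (fun z => (starRingEnd ℂ) (F z)) := by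
  obtain ⟨c, hc⟩ := hF
  exact ⟨c, fun z => by simpa using hc z⟩

lemma HasDecay.mono {k l : ℕ} {F : ℂ → ℂ} (hF : HasDecay k F) (h : l ≤ k) :
    HasDecay l F := by
  obtain ⟨c, hc⟩ := hF
  have hc0 : 0 ≤ c := by
    have := (norm_nonneg _).trans (hc 0)
    simpa using this
  refine ⟨c, fun z => (hc z).trans ?_⟩
  refine mul_le_mul_of_nonneg_left (pow_le_pow_of_le_one (by positivity) ?_ h) hc0
  exact inv_le_one_of_one_le₀ (by linarith [norm_nonneg z])

lemma HasDecay.comp_sub {k : ℕ} {F : ℂ → ℂ} (hF : HasDecay k F) (w : ℂ) :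
    HasDecay k (fun z => F (z - w)) := by
  obtain ⟨c, hc⟩ := hF
  have hc0 : 0 ≤ c := by
    have := (norm_nonneg _).trans (hc 0)
    simpa using this
  refine ⟨c * (1 + ‖w‖) ^ k, fun z => (hc _).trans ?_⟩
  rw [mul_assoc, ← mul_pow]
  gcongr
  rw [← div_eq_mul_inv, inv_eq_one_div, div_le_div_iff₀ (by positivity) (by positivity)]
  have : ‖z‖ ≤ ‖z - w‖ + ‖w‖ := by simpa using norm_add_le (z - w) w
  nlinarith [norm_nonneg w, norm_nonneg (z - w)]

lemma integrable_inv_one_add_norm_pow_three :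
    Integrable (fun z : ℂ => ((1 + ‖z‖)⁻¹) ^ 3) := by
  have := integrable_one_add_norm (E := ℂ) (μ := volume) (r := 3)
    (by rw [Complex.finrank_real_complex]; norm_num)
  refine this.congr (Filter.Eventually.of_forall fun z => ?_)
  simp only
  rw [Real.rpow_neg (by positivity), inv_pow]
  norm_cast

lemma HasDecay.integrable {k : ℕ} {F : ℂ → ℂ} (hF : HasDecay k F) (hk : 3 ≤ k)
    (hc : Continuous F) : Integrable F := by
  obtain ⟨c, hc'⟩ := hF.mono hk
  exact (integrable_inv_one_add_norm_pow_three.const_mul c).mono' hc.aestronglyMeasurable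
    (Filter.Eventually.of_forall hc')

/-- The regularised Cauchy kernel `z̄ / (|z|² + ε)`. -/
noncomputable def regCauchy (ε : ℝ) (z : ℂ) : ℂ :=
  (starRingEnd ℂ) z * (z * (starRingEnd ℂ) z + ε)⁻¹

/-- The regularised Beurling kernel `-z̄² / (|z|² + ε)²`, the `∂`-derivative of `regCauchy`. -/
noncomputable def regBeurling (ε : ℝ) (z : ℂ) : ℂ := -regCauchy ε z ^ 2

/-- The approximate identity `ε / (|z|² + ε)²`, the `∂̄`-derivative of `regCauchy`. -/
noncomputable def regDelta (ε : ℝ) (z : ℂ) : ℂ :=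
  ε * ((z * (starRingEnd ℂ) z + ε)⁻¹ * (z * (starRingEnd ℂ) z + ε)⁻¹)

section kernels

variable {ε : ℝ}

lemma norm_mul_conj_add (hε : 0 < ε) (z : ℂ) : ‖z * (starRingEnd ℂ) z + ε‖ = ‖z‖ ^ 2 + ε := by
  rw [Complex.mul_conj', ← Complex.ofReal_pow, ← Complex.ofReal_add, Complex.norm_real,
    Real.norm_of_nonneg (by positivity)]

lemma mul_conj_add_ne_zero (hε : 0 < ε) (z : ℂ) : z * (starRingEnd ℂ) z + ε ≠ 0 := by
  rw [← norm_ne_zero_iff, norm_mul_conj_add hε]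
  positivity

lemma norm_regCauchy (hε : 0 < ε) (z : ℂ) : ‖regCauchy ε z‖ = ‖z‖ / (‖z‖ ^ 2 + ε) := by
  rw [regCauchy, norm_mul, norm_inv, norm_mul_conj_add hε, RCLike.norm_conj, div_eq_mul_inv]

lemma norm_regDelta (hε : 0 < ε) (z : ℂ) : ‖regDelta ε z‖ = ε / (‖z‖ ^ 2 + ε) ^ 2 := by
  rw [regDelta, norm_mul, norm_mul, norm_inv, norm_mul_conj_add hε, Complex.norm_real,
    Real.norm_of_nonneg hε.le]
  field_simp

lemma continuous_regCauchy (hε : 0 < ε) : Continuous (regCauchy ε) := by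
  unfold regCauchy
  exact Complex.continuous_conj.mul (Continuous.inv₀ (by fun_prop) (mul_conj_add_ne_zero hε))

lemma continuous_regBeurling (hε : 0 < ε) : Continuous (regBeurling ε) :=
  ((continuous_regCauchy hε).pow 2).neg

lemma continuous_regDelta (hε : 0 < ε) : Continuous (regDelta ε) := by
  unfold regDelta
  have : Continuous fun z : ℂ => (z * (starRingEnd ℂ) z + ε)⁻¹ :=
    Continuous.inv₀ (by fun_prop) (mul_conj_add_ne_zero hε)
  fun_prop

lemma hasFDerivAt_inv_mul_conj_add (hε : 0 < ε) (z : ℂ) :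
    HasFDerivAt (fun z : ℂ => (z * (starRingEnd ℂ) z + ε)⁻¹)
      (wirtinger (-(starRingEnd ℂ) z / (z * (starRingEnd ℂ) z + ε) ^ 2)
        (-z / (z * (starRingEnd ℂ) z + ε) ^ 2)) z := by
  have h1 := (hasFDerivAt_wirtinger_mul (hasFDerivAt_wirtinger_id z)
    (hasFDerivAt_wirtinger_conj (hasFDerivAt_wirtinger_id z))).add_const (ε : ℂ)
  have h2 := hasFDerivAt_wirtinger_inv h1 (mul_conj_add_ne_zero hε z)
  simpa using h2

lemma hasFDerivAt_regCauchy (hε : 0 < ε) (z : ℂ) :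
    HasFDerivAt (regCauchy ε) (wirtinger (regBeurling ε z) (regDelta ε z)) z := by
  have h := hasFDerivAt_wirtinger_mul (hasFDerivAt_wirtinger_conj (hasFDerivAt_wirtinger_id z))
    (hasFDerivAt_inv_mul_conj_add hε z)
  have h0 := mul_conj_add_ne_zero hε z
  refine h.congr_fderiv ?_
  congr 1
  · simp only [regBeurling, regCauchy, map_zero]
    field_simp
    ring
  · simp only [regDelta, map_one]
    field_simp
    ring

lemma hasFDerivAt_regDelta (hε : 0 < ε) (z : ℂ) :
    HasFDerivAt (regDelta ε) (wirtinger (-2 * (regDelta ε z * regCauchy ε z))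
      (-2 * (regDelta ε z * (starRingEnd ℂ) (regCauchy ε z)))) z := by
  have h := hasFDerivAt_wirtinger_mul (hasFDerivAt_inv_mul_conj_add hε z)
    (hasFDerivAt_inv_mul_conj_add hε z)
  have h' := (h.const_mul (ε : ℂ))
  have h0 := mul_conj_add_ne_zero hε z
  refine h'.congr_fderiv ?_
  have h1 : (starRingEnd ℂ) z * z + ε = z * (starRingEnd ℂ) z + ε := by ring
  ext e
  simp [regDelta, regCauchy, h1]
  field_simp
  ring_nf

lemma conj_regDelta (z : ℂ) : (starRingEnd ℂ) (regDelta ε z) = regDelta ε z := by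
  simp [regDelta, mul_comm]

lemma hasDecay_regCauchy (hε : 0 < ε) : HasDecay 1 (regCauchy ε) := by
  refine ⟨2 + 2 / ε, fun z => ?_⟩
  rw [norm_regCauchy hε, pow_one, ← div_eq_mul_inv,
    div_le_div_iff₀ (by positivity) (by positivity)]
  have : 2 / ε * ε = 2 := by field_simp
  have h2 : 0 ≤ 2 / ε * ‖z‖ ^ 2 := by positivity
  nlinarith [sq_nonneg (‖z‖ - 1), norm_nonneg z]

lemma hasDecay_regBeurling (hε : 0 < ε) : HasDecay 2 (regBeurling ε) := by
  obtain ⟨c, hc⟩ := (hasDecay_regCauchy hε).mul (hasDecay_regCauchy hε)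
  refine ⟨c, fun z => ?_⟩
  simpa [regBeurling, sq] using hc z

lemma hasDecay_four_regDelta (hε : 0 < ε) : HasDecay 4 (regDelta ε) := by
  have h : HasDecay 2 fun z : ℂ => (z * (starRingEnd ℂ) z + ε)⁻¹ := by
    refine ⟨2 + 2 / ε, fun z => ?_⟩
    rw [norm_inv, norm_mul_conj_add hε, inv_pow, ← div_eq_mul_inv, ← one_div,
      div_le_div_iff₀ (by positivity) (by positivity)]
    have : 2 / ε * ε = 2 := by field_simp
    have h2 : 0 ≤ 2 / ε * ‖z‖ ^ 2 := by positivity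
    nlinarith [sq_nonneg (‖z‖ - 1), norm_nonneg z]
  exact (h.mul h).const_mul _

lemma hasDecay_regDelta (hε : 0 < ε) : HasDecay 2 (regDelta ε) :=
  (hasDecay_four_regDelta hε).mono (by norm_num)

lemma integral_regBeurling_mul_conj (hε : 0 < ε) (w w' : ℂ) :
    ∫ z, regBeurling ε (z - w) * (starRingEnd ℂ) (regBeurling ε (z - w')) =
      ∫ z, regDelta ε (z - w) * regDelta ε (z - w') := by
  have cC := continuous_regCauchy hε
  have cB := continuous_regBeurling hε
  have cD := continuous_regDelta hε
  have dC := hasDecay_regCauchy hε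
  have dB := hasDecay_regBeurling hε
  have dD := hasDecay_regDelta hε
  have hu : ∀ z, HasFDerivAt (fun z => regCauchy ε (z - w))
      (wirtinger (regBeurling ε (z - w)) (regDelta ε (z - w))) z := fun z =>
    hasFDerivAt_wirtinger_comp_sub w (hasFDerivAt_regCauchy hε (z - w))
  have hv : ∀ z, HasFDerivAt (fun z => (starRingEnd ℂ) (regCauchy ε (z - w')))
      (wirtinger (regDelta ε (z - w')) ((starRingEnd ℂ) (regBeurling ε (z - w')))) z := by
    intro z
    have := hasFDerivAt_wirtinger_conj (hasFDerivAt_wirtinger_comp_sub w'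
      (hasFDerivAt_regCauchy hε (z - w')))
    rwa [conj_regDelta] at this
  have hN : ∀ z, HasFDerivAt (fun z => regDelta ε (z - w')) _ z := fun z =>
    hasFDerivAt_wirtinger_comp_sub w' (hasFDerivAt_regDelta hε (z - w'))
  have hF := fun z => hasFDerivAt_wirtinger_mul (hasFDerivAt_wirtinger_mul (hu z) (hv z)) (hv z)
  have hG := fun z => hasFDerivAt_wirtinger_mul (hu z) (hN z)
  have dCw := dC.comp_sub w
  have dBw := dB.comp_sub w
  have dDw := dD.comp_sub w
  have dCw' := (dC.comp_sub w').conj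
  have dCw'' := dC.comp_sub w'
  have dBw' := (dB.comp_sub w').conj
  have dDw' := dD.comp_sub w'
  have eF := (integral_wirtinger_eq_zero hF
    (((dCw.mul dCw').mul dCw').integrable (by norm_num) (by fun_prop))
    ((((dCw.mul dCw').mul dDw').add
      (((dCw.mul dDw').add (dBw.mul dCw')).mul dCw')).integrable (by norm_num) (by fun_prop))
    ((((dCw.mul dCw').mul dBw').add
      (((dCw.mul dBw').add (dDw.mul dCw')).mul dCw')).integrable (by norm_num) (by fun_prop))).1
  have eG := (integral_wirtinger_eq_zero hG
    ((dCw.mul dDw').integrable (by norm_num) (by fun_prop))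
    (((dCw.mul ((dDw'.mul dCw'').const_mul (-2))).mono (by norm_num) |>.add
      (dBw.mul dDw')).integrable (by norm_num) (by fun_prop))
    (((dCw.mul ((dDw'.mul dCw').const_mul (-2))).mono (by norm_num) |>.add
      (dDw.mul dDw')).integrable (by norm_num) (by fun_prop))).2
  have iB := (dBw.mul dBw').integrable (by norm_num) (by fun_prop)
  have iD := (dDw.mul dDw').integrable (by norm_num) (by fun_prop)
  have iR := ((dCw.mul dCw').mul dDw').integrable (by norm_num) (by fun_prop)
  have e1 : ∫ z, regBeurling ε (z - w) * (starRingEnd ℂ) (regBeurling ε (z - w')) =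
      2 * ∫ z, (regCauchy ε (z - w) * (starRingEnd ℂ) (regCauchy ε (z - w')))
        * regDelta ε (z - w') := by
    rw [← integral_const_mul, ← sub_eq_zero, ← integral_sub iB (iR.const_mul 2), ← neg_eq_zero,
      ← integral_neg, ← eF]
    congr 1
    ext z
    simp only [regBeurling, map_neg, map_pow]
    ring
  have e2 : ∫ z, regDelta ε (z - w) * regDelta ε (z - w') =
      2 * ∫ z, (regCauchy ε (z - w) * (starRingEnd ℂ) (regCauchy ε (z - w')))
        * regDelta ε (z - w') := by
    rw [← integral_const_mul, ← sub_eq_zero, ← integral_sub iD (iR.const_mul 2), ← eG]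
    congr 1
    ext z
    ring
  rw [e1, e2]

end kernels

/-- Convolution of `g` with the kernel `k`. -/
noncomputable def kernelConv (k g : ℂ → ℂ) (z : ℂ) : ℂ := ∫ w, k (z - w) * g w

section gram

variable {k g : ℂ → ℂ}

lemma integral_norm_mul_norm_sub_le (hk : Continuous k) (hd : HasDecay 2 k) (w w' : ℂ) :
    Integrable (fun z => k (z - w) * (starRingEnd ℂ) (k (z - w'))) ∧
    ∫ z, ‖k (z - w) * (starRingEnd ℂ) (k (z - w'))‖ ≤ ∫ z, ‖k z‖ ^ 2 := by
  have h0 : Integrable (fun z => ‖k z‖ ^ 2) := by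
    have := ((hd.mul hd).integrable (by norm_num) (by fun_prop)).norm
    simpa [sq] using this
  have hi : Integrable (fun z => k (z - w) * (starRingEnd ℂ) (k (z - w'))) :=
    ((hd.comp_sub w).mul (hd.comp_sub w').conj).integrable (by norm_num) (by fun_prop)
  refine ⟨hi, ?_⟩
  have h1 : ∀ w, Integrable (fun z => ‖k (z - w)‖ ^ 2) := fun w => h0.comp_sub_right w
  have h2 : ∀ w, ∫ z, ‖k (z - w)‖ ^ 2 = ∫ z, ‖k z‖ ^ 2 := fun w =>
    integral_sub_right_eq_self (fun z => ‖k z‖ ^ 2) w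
  calc ∫ z, ‖k (z - w) * (starRingEnd ℂ) (k (z - w'))‖
      ≤ ∫ z, (‖k (z - w)‖ ^ 2 + ‖k (z - w')‖ ^ 2) / 2 := by
        refine integral_mono hi.norm (((h1 w).add (h1 w')).div_const 2) fun z => ?_
        simp only [norm_mul, RCLike.norm_conj]
        nlinarith [sq_nonneg (‖k (z - w)‖ - ‖k (z - w')‖)]
    _ = _ := by
        rw [integral_div, integral_add (h1 w) (h1 w'), h2, h2]
        ring

lemma integrable_gram (hk : Continuous k) (hd : HasDecay 2 k) (hgm : Measurable g)
    (hg : Integrable g) :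
    Integrable (fun q : ℂ × ℂ × ℂ => (k (q.1 - q.2.1) * (starRingEnd ℂ) (k (q.1 - q.2.2))) *
      (g q.2.1 * (starRingEnd ℂ) (g q.2.2))) (volume.prod (volume.prod volume)) := by
  have hm : Measurable (fun q : ℂ × ℂ × ℂ =>
      (k (q.1 - q.2.1) * (starRingEnd ℂ) (k (q.1 - q.2.2))) *
      (g q.2.1 * (starRingEnd ℂ) (g q.2.2))) := by
    have hkm := hk.measurable
    have hc : Measurable (starRingEnd ℂ) := Complex.continuous_conj.measurable
    fun_prop
  rw [integrable_prod_iff' hm.aestronglyMeasurable]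
  constructor
  · refine Filter.Eventually.of_forall fun p => ?_
    have := (integral_norm_mul_norm_sub_le hk hd p.1 p.2).1
    exact this.mul_const (g p.1 * (starRingEnd ℂ) (g p.2))
  · refine ((hg.norm.mul_prod hg.norm).const_mul (∫ z, ‖k z‖ ^ 2)).mono'
      hm.norm.aestronglyMeasurable.prod_swap.integral_prod_right'
      (Filter.Eventually.of_forall fun p => ?_)
    rw [Real.norm_of_nonneg (integral_nonneg fun _ => norm_nonneg _)]
    simp only [norm_mul _ (g _ * _)]
    rw [integral_mul_const]
    simp only [norm_mul (g _), RCLike.norm_conj]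
    exact mul_le_mul_of_nonneg_right (integral_norm_mul_norm_sub_le hk hd p.1 p.2).2
      (by positivity)

lemma integral_gram_inner (z : ℂ) :
    ∫ p : ℂ × ℂ, (k (z - p.1) * (starRingEnd ℂ) (k (z - p.2))) *
      (g p.1 * (starRingEnd ℂ) (g p.2)) = ((‖kernelConv k g z‖ ^ 2 : ℝ) : ℂ) := by
  rw [Complex.ofReal_pow, ← Complex.mul_conj', kernelConv, ← integral_conj,
    ← integral_prod_mul]
  congr 1
  ext p
  simp only [map_mul]
  ring

lemma integral_norm_sq_kernelConv (hk : Continuous k) (hd : HasDecay 2 k) (hgm : Measurable g)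
    (hg : Integrable g) :
    Integrable (fun z => ‖kernelConv k g z‖ ^ 2) ∧
    ((∫ z, ‖kernelConv k g z‖ ^ 2 : ℝ) : ℂ) =
      ∫ p : ℂ × ℂ, (∫ z, k (z - p.1) * (starRingEnd ℂ) (k (z - p.2))) *
        (g p.1 * (starRingEnd ℂ) (g p.2)) := by
  have hi := integrable_gram hk hd hgm hg
  have h1 := hi.integral_prod_left
  simp only [← Measure.volume_eq_prod, integral_gram_inner] at h1
  refine ⟨by simpa only [RCLike.re_to_complex, Complex.ofReal_re] using h1.re, ?_⟩
  rw [← integral_complex_ofReal]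
  simp only [← integral_gram_inner]
  rw [Measure.volume_eq_prod, integral_integral_swap hi]
  simp only [integral_mul_const]

end gram

lemma integral_norm_sq_regBeurling_conv {ε : ℝ} (hε : 0 < ε) {g : ℂ → ℂ} (hgm : Measurable g)
    (hg : Integrable g) :
    ∫ z, ‖kernelConv (regBeurling ε) g z‖ ^ 2 = ∫ z, ‖kernelConv (regDelta ε) g z‖ ^ 2 := by
  have h1 := (integral_norm_sq_kernelConv (continuous_regBeurling hε) (hasDecay_regBeurling hε)
    hgm hg).2
  have h2 := (integral_norm_sq_kernelConv (continuous_regDelta hε) (hasDecay_regDelta hε)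
    hgm hg).2
  simp only [integral_regBeurling_mul_conj hε] at h1
  simp only [conj_regDelta] at h2
  exact_mod_cast h1.trans h2.symm

lemma lintegral_mul_sq_le {α : Type*} [MeasurableSpace α] {μ : Measure α} {n g : α → ℝ≥0∞}
    (hn : Measurable n) (hg : Measurable g) :
    (∫⁻ x, n x * g x ∂μ) ^ 2 ≤ (∫⁻ x, n x ∂μ) * ∫⁻ x, n x * g x ^ 2 ∂μ := by
  have h := ENNReal.lintegral_mul_le_Lp_mul_Lq μ Real.HolderConjugate.two_two
    (f := fun x => n x ^ (1 / 2 : ℝ)) (g := fun x => n x ^ (1 / 2 : ℝ) * g x)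
    (hn.pow_const _).aemeasurable ((hn.pow_const _).mul hg).aemeasurable
  have e : ∀ x : ℝ≥0∞, x ^ (1 / 2 : ℝ) * x ^ (1 / 2 : ℝ) = x := fun x => by
    rw [← ENNReal.rpow_add_of_nonneg _ _ (by norm_num) (by norm_num)]
    norm_num
  simp only [Pi.mul_apply, ← mul_assoc, e, ENNReal.rpow_two, mul_pow, sq (_ ^ (1 / 2 : ℝ))] at h
  calc (∫⁻ x, n x * g x ∂μ) ^ 2 ≤ _ := pow_le_pow_left' h 2
    _ = _ := by rw [mul_pow, sq (_ ^ (1 / 2 : ℝ)), sq (_ ^ (1 / 2 : ℝ)), e, e]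

lemma enorm_kernelConv_le (k g : ℂ → ℂ) (z : ℂ) :
    ‖kernelConv k g z‖ₑ ≤ ∫⁻ w, ‖k (z - w)‖ₑ * ‖g w‖ₑ := by
  refine (enorm_integral_le_lintegral_enorm _).trans_eq ?_
  simp only [enorm_mul]

lemma lintegral_sq_kernelConv_le {k g : ℂ → ℂ} (hk : Measurable k) (hg : Measurable g) :
    ∫⁻ z, ‖kernelConv k g z‖ₑ ^ 2 ≤ (∫⁻ z, ‖k z‖ₑ) ^ 2 * ∫⁻ z, ‖g z‖ₑ ^ 2 := by
  calc ∫⁻ z, ‖kernelConv k g z‖ₑ ^ 2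
      ≤ ∫⁻ z, (∫⁻ w, ‖k w‖ₑ) * ∫⁻ w, ‖k (z - w)‖ₑ * ‖g w‖ₑ ^ 2 := by
        refine lintegral_mono fun z => ?_
        refine (pow_le_pow_left' (enorm_kernelConv_le k g z) 2).trans ?_
        refine (lintegral_mul_sq_le (by fun_prop) (by fun_prop)).trans_eq ?_
        rw [lintegral_sub_left_eq_self (fun w => ‖k w‖ₑ) z]
    _ = (∫⁻ w, ‖k w‖ₑ) * ∫⁻ w, ∫⁻ z, ‖k (z - w)‖ₑ * ‖g w‖ₑ ^ 2 := by
        rw [lintegral_const_mul, lintegral_lintegral_swap]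
        · exact Measurable.aemeasurable (by fun_prop)
        · exact Measurable.lintegral_prod_right'
            (f := fun q : ℂ × ℂ => ‖k (q.1 - q.2)‖ₑ * ‖g q.2‖ₑ ^ 2) (by fun_prop)
    _ = _ := by
        have : ∀ w, ∫⁻ z, ‖k (z - w)‖ₑ * ‖g w‖ₑ ^ 2 = (∫⁻ z, ‖k z‖ₑ) * ‖g w‖ₑ ^ 2 := fun w => by
          rw [lintegral_mul_const _ (by fun_prop),
            lintegral_sub_right_eq_self (fun z => ‖k z‖ₑ) w]
        simp only [this]
        rw [lintegral_const_mul _ (by fun_prop), sq, mul_assoc]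

lemma lintegral_regDelta {ε : ℝ} (hε : 0 < ε) :
    ∫⁻ z, ‖regDelta ε z‖ₑ = ∫⁻ z, ‖regDelta 1 z‖ₑ := by
  have hi : ∀ {ε : ℝ}, 0 < ε → ∫⁻ z, ‖regDelta ε z‖ₑ =
      ENNReal.ofReal (∫ z : ℂ, ε / (‖z‖ ^ 2 + ε) ^ 2) := fun {ε} hε => by
    have := (hasDecay_four_regDelta hε).integrable (by norm_num) (continuous_regDelta hε)
    rw [← ofReal_integral_norm_eq_lintegral_enorm this]
    simp only [norm_regDelta hε]
  rw [hi hε, hi one_pos]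
  congr 1
  have h := Measure.integral_comp_smul (volume : Measure ℂ)
    (fun z : ℂ => ε / (‖z‖ ^ 2 + ε) ^ 2) (√ε)
  rw [Complex.finrank_real_complex, Real.sq_sqrt hε.le, abs_of_pos (by positivity),
    smul_eq_mul, eq_inv_mul_iff_mul_eq₀ hε.ne', ← integral_const_mul] at h
  rw [← h]
  congr 1
  ext z
  rw [norm_smul, mul_pow, Real.norm_eq_abs, sq_abs, Real.sq_sqrt hε.le]
  field_simp

/-- The regularised Beurling transforms are bounded on `L²`, uniformly in the parameter. -/
lemma lintegral_sq_regBeurling_conv_le {ε : ℝ} (hε : 0 < ε) {g : ℂ → ℂ} (hgm : Measurable g)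
    (hg : Integrable g) :
    ∫⁻ z, ‖kernelConv (regBeurling ε) g z‖ₑ ^ 2 ≤
      (∫⁻ z, ‖regDelta 1 z‖ₑ) ^ 2 * ∫⁻ z, ‖g z‖ₑ ^ 2 := by
  have e : ∀ k : ℂ → ℂ, Continuous k → HasDecay 2 k → ∫⁻ z, ‖kernelConv k g z‖ₑ ^ 2 =
      ENNReal.ofReal (∫ z, ‖kernelConv k g z‖ ^ 2) := fun k hk hd => by
    rw [ofReal_integral_eq_lintegral_ofReal (integral_norm_sq_kernelConv hk hd hgm hg).1
      (Filter.Eventually.of_forall fun _ => by positivity)]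
    congr 1
    ext z
    rw [ENNReal.ofReal_pow (norm_nonneg _), ofReal_norm]
  rw [e _ (continuous_regBeurling hε) (hasDecay_regBeurling hε),
    integral_norm_sq_regBeurling_conv hε hgm hg,
    ← e _ (continuous_regDelta hε) (hasDecay_regDelta hε), ← lintegral_regDelta hε]
  exact lintegral_sq_kernelConv_le (continuous_regDelta hε).measurable hgm

lemma HasDecay.exists_norm_le {k : ℕ} {F : ℂ → ℂ} (hF : HasDecay k F) :
    ∃ c : ℝ, ∀ z, ‖F z‖ ≤ c := by
  obtain ⟨c, hc⟩ := hF.mono (Nat.zero_le k)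
  exact ⟨c, fun z => by simpa using hc z⟩

lemma HasDecay.integrable_kernel_mul {n : ℕ} {k g : ℂ → ℂ} (hd : HasDecay n k)
    (hk : Continuous k) (hg : Integrable g) (z : ℂ) :
    Integrable (fun w => k (z - w) * g w) := by
  obtain ⟨c, hc⟩ := hd.exists_norm_le
  exact hg.bdd_mul (c := c) (by fun_prop) (Filter.Eventually.of_forall fun w => hc _)

section kernelConv_algebra

variable {n : ℕ} {k f g : ℂ → ℂ}

lemma kernelConv_add (hd : HasDecay n k) (hk : Continuous k) (hf : Integrable f)
    (hg : Integrable g) (z : ℂ) :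
    kernelConv k (fun w => f w + g w) z = kernelConv k f z + kernelConv k g z := by
  simp only [kernelConv, mul_add]
  exact integral_add (hd.integrable_kernel_mul hk hf z) (hd.integrable_kernel_mul hk hg z)

lemma continuous_kernelConv (hd : HasDecay n k) (hk : Continuous k) (hg : Integrable g) :
    Continuous (kernelConv k g) := by
  obtain ⟨c, hc⟩ := hd.exists_norm_le
  refine continuous_of_dominated (bound := fun w => c * ‖g w‖)
    (fun z => (hd.integrable_kernel_mul hk hg z).aestronglyMeasurable)
    (fun z => Filter.Eventually.of_forall fun w => ?_) (hg.norm.const_mul c)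
    (Filter.Eventually.of_forall fun w => by fun_prop)
  rw [norm_mul]
  exact mul_le_mul_of_nonneg_right (hc _) (norm_nonneg _)

end kernelConv_algebra

section hormander

variable {ε : ℝ}

lemma norm_regCauchy_le (hε : 0 < ε) (z : ℂ) : ‖regCauchy ε z‖ ≤ ‖z‖⁻¹ := by
  rcases eq_or_ne z 0 with rfl | h
  · simp [regCauchy]
  · have := norm_pos_iff.mpr h
    rw [norm_regCauchy hε, inv_eq_one_div, div_le_div_iff₀ (by positivity) this]
    nlinarith

lemma norm_regCauchy_sub_le (hε : 0 < ε) {a b : ℂ} (ha : a ≠ 0) (hb : b ≠ 0) :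
    ‖regCauchy ε a - regCauchy ε b‖ ≤ ‖a - b‖ * (‖a‖⁻¹ * ‖b‖⁻¹) := by
  have ha' := norm_pos_iff.mpr ha
  have hb' := norm_pos_iff.mpr hb
  have h1 := mul_conj_add_ne_zero hε a
  have h2 := mul_conj_add_ne_zero hε b
  have e : regCauchy ε a - regCauchy ε b =
      ((starRingEnd ℂ) a * (starRingEnd ℂ) b * (b - a) + ε * ((starRingEnd ℂ) (a - b))) /
        ((a * (starRingEnd ℂ) a + ε) * (b * (starRingEnd ℂ) b + ε)) := by
    have h : ∀ x y d d' : ℂ, d ≠ 0 → d' ≠ 0 →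
        x * d⁻¹ - y * d'⁻¹ = (x * d' - y * d) / (d * d') := fun x y d d' hd hd' => by
      field_simp
    rw [regCauchy, regCauchy, h _ _ _ _ h1 h2, map_sub]
    congr 1
    ring
  have h3 : ‖(starRingEnd ℂ) a * (starRingEnd ℂ) b * (b - a) + ε * ((starRingEnd ℂ) (a - b))‖ ≤
      (‖a‖ * ‖b‖ + ε) * ‖a - b‖ := by
    refine (norm_add_le _ _).trans_eq ?_
    simp only [norm_mul, RCLike.norm_conj, Complex.norm_real, norm_sub_rev b a,
      Real.norm_of_nonneg hε.le]
    ring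
  rw [e, norm_div, norm_mul, norm_mul_conj_add hε, norm_mul_conj_add hε, ← mul_inv,
    ← div_eq_mul_inv, div_le_div_iff₀ (by positivity) (by positivity)]
  calc _ ≤ (‖a‖ * ‖b‖ + ε) * ‖a - b‖ * (‖a‖ * ‖b‖) := by gcongr
    _ = ‖a - b‖ * ((‖a‖ * ‖b‖ + ε) * (‖a‖ * ‖b‖)) := by ring
    _ ≤ _ := by
      refine mul_le_mul_of_nonneg_left ?_ (norm_nonneg _)
      nlinarith [mul_nonneg hε.le (sq_nonneg (‖a‖ - ‖b‖)), mul_pos ha' hb', sq_nonneg ‖a‖,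
        sq_nonneg ‖b‖, mul_pos hε hε, mul_pos hε (mul_pos ha' hb'),
        mul_pos hε (mul_pos ha' ha'), mul_pos hε (mul_pos hb' hb')]

lemma norm_regBeurling_sub_le (hε : 0 < ε) {z w c : ℂ} {r : ℝ} (hr : 0 < r) (hw : ‖w - c‖ ≤ r)
    (hz : 2 * r < ‖z - c‖) :
    ‖regBeurling ε (z - w) - regBeurling ε (z - c)‖ ≤ 21 * (r * ((r + ‖z - c‖)⁻¹) ^ 3) := by
  have hb : 0 < ‖z - c‖ := by linarith
  have hab : ‖z - c‖ ≤ 2 * ‖z - w‖ := by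
    have : ‖z - c‖ ≤ ‖z - w‖ + ‖w - c‖ := norm_sub_le_norm_sub_add_norm_sub z w c
    linarith
  have ha : 0 < ‖z - w‖ := by linarith
  have hinv : ‖z - w‖⁻¹ ≤ 2 * ‖z - c‖⁻¹ := by
    rw [← div_eq_mul_inv, inv_eq_one_div, div_le_div_iff₀ ha hb]
    linarith
  have h1 := norm_regCauchy_sub_le hε (norm_pos_iff.mp ha) (norm_pos_iff.mp hb)
  have h2 : ‖regCauchy ε (z - w) + regCauchy ε (z - c)‖ ≤ 3 * ‖z - c‖⁻¹ := by
    refine (norm_add_le _ _).trans ?_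
    linarith [norm_regCauchy_le hε (z - w), norm_regCauchy_le hε (z - c)]
  have h3 : ‖z - w - (z - c)‖ ≤ r := by
    rwa [sub_sub_sub_cancel_left, norm_sub_rev]
  have e : regBeurling ε (z - w) - regBeurling ε (z - c) =
      -((regCauchy ε (z - w) - regCauchy ε (z - c)) *
        (regCauchy ε (z - w) + regCauchy ε (z - c))) := by
    simp only [regBeurling]
    ring
  rw [e, norm_neg, norm_mul]
  have h4 : ‖z - c‖⁻¹ ≤ 3 / 2 * (r + ‖z - c‖)⁻¹ := by
    rw [← div_eq_mul_inv, inv_eq_one_div, div_le_div_iff₀ hb (by positivity)]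
    linarith
  calc _ ≤ (r * (2 * ‖z - c‖⁻¹ * ‖z - c‖⁻¹)) * (3 * ‖z - c‖⁻¹) := by
        refine mul_le_mul (h1.trans ?_) h2 (norm_nonneg _) (by positivity)
        gcongr
    _ = 6 * r * ‖z - c‖⁻¹ ^ 3 := by ring
    _ ≤ 6 * r * (3 / 2 * (r + ‖z - c‖)⁻¹) ^ 3 := by gcongr
    _ ≤ _ := by
        rw [mul_pow]
        have : 0 < r * ((r + ‖z - c‖)⁻¹) ^ 3 := by positivity
        nlinarith

/-- The constant in the Hörmander condition. -/
noncomputable def hormanderConst : ℝ≥0∞ :=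
  ENNReal.ofReal (∫ z : ℂ, 21 * ((1 + ‖z‖)⁻¹) ^ 3)

lemma lintegral_hormander {r : ℝ} (hr : 0 < r) (c : ℂ) :
    ∫⁻ z : ℂ, ENNReal.ofReal (21 * (r * ((r + ‖z - c‖)⁻¹) ^ 3)) = hormanderConst := by
  have hcomp : ∀ y : ℂ, r * ((r + ‖r • y‖)⁻¹) ^ 3 = (r ^ 2)⁻¹ * ((1 + ‖y‖)⁻¹) ^ 3 := fun y => by
    rw [norm_smul, Real.norm_of_nonneg hr.le]
    have : 0 < 1 + ‖y‖ := by positivity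
    field_simp
  have hi : Integrable fun z : ℂ => r * ((r + ‖z‖)⁻¹) ^ 3 := by
    rw [← integrable_comp_smul_iff volume _ hr.ne']
    simp only [hcomp]
    exact integrable_inv_one_add_norm_pow_three.const_mul _
  have h := Measure.integral_comp_smul (volume : Measure ℂ)
    (fun z : ℂ => r * ((r + ‖z‖)⁻¹) ^ 3) r
  simp only [hcomp] at h
  rw [Complex.finrank_real_complex, integral_const_mul, abs_of_pos (by positivity),
    smul_eq_mul, mul_right_inj' (by positivity)] at h
  rw [lintegral_sub_right_eq_self (fun z : ℂ => ENNReal.ofReal (21 * (r * ((r + ‖z‖)⁻¹) ^ 3))) c,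
    ← ofReal_integral_eq_lintegral_ofReal (hi.const_mul 21)
      (Filter.Eventually.of_forall fun _ => by positivity), hormanderConst, integral_const_mul,
    integral_const_mul 21 (fun z : ℂ => ((1 + ‖z‖)⁻¹) ^ 3), h]

lemma lintegral_compl_regBeurling_conv_le (hε : 0 < ε) {b : ℂ → ℂ} (hb : Integrable b)
    {c : ℂ} {r : ℝ} (hr : 0 < r) (hsupp : ∀ w ∉ Metric.closedBall c r, b w = 0)
    (h0 : ∫ w, b w = 0) :
    ∫⁻ z in (Metric.closedBall c (2 * r))ᶜ, ‖kernelConv (regBeurling ε) b z‖ₑ ≤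
      hormanderConst * ∫⁻ w, ‖b w‖ₑ := by
  have hd := hasDecay_regBeurling hε
  have hk := continuous_regBeurling hε
  have hp : ∀ z ∈ (Metric.closedBall c (2 * r))ᶜ, ‖kernelConv (regBeurling ε) b z‖ₑ ≤
      ENNReal.ofReal (21 * (r * ((r + ‖z - c‖)⁻¹) ^ 3)) * ∫⁻ w, ‖b w‖ₑ := by
    intro z hz
    have hz' : 2 * r < ‖z - c‖ := by simpa [dist_eq_norm] using hz
    have e : kernelConv (regBeurling ε) b z =
        ∫ w, (regBeurling ε (z - w) - regBeurling ε (z - c)) * b w := by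
      simp only [sub_mul]
      rw [integral_sub (hd.integrable_kernel_mul hk hb z) (hb.const_mul _), integral_const_mul,
        h0, mul_zero, sub_zero, kernelConv]
    rw [e, ← lintegral_const_mul' _ _ ENNReal.ofReal_ne_top]
    refine (enorm_integral_le_lintegral_enorm _).trans (lintegral_mono fun w => ?_)
    by_cases hw : w ∈ Metric.closedBall c r
    · rw [enorm_mul, ← ofReal_norm (regBeurling _ _ - _)]
      gcongr
      exact norm_regBeurling_sub_le hε hr (by simpa [dist_eq_norm] using hw) hz'
    · simp [hsupp w hw]
  refine (setLIntegral_mono' Metric.isClosed_closedBall.measurableSet.compl hp).trans ?_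
  refine (setLIntegral_le_lintegral _ _).trans ?_
  rw [lintegral_mul_const _ (by fun_prop), lintegral_hormander hr]

end hormander

/-- A Calderón–Zygmund decomposition at height `α` of the restriction of `f` to `S`: the function
`g` is its good part, and the transform of the bad part is integrable outside of `E`. -/
def HasCZDecomposition (ε α : ℝ) (f : ℂ → ℂ) (S : Set ℂ) : Prop :=
  ∃ (g : ℂ → ℂ) (E : Set ℂ), Measurable g ∧ MeasurableSet E ∧ (∀ z ∉ S, g z = 0) ∧
    (∀ z, ‖g z‖ ≤ 4 * α) ∧ ∫⁻ z, ‖g z‖ₑ ≤ ∫⁻ z in S, ‖f z‖ₑ ∧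
    ENNReal.ofReal α * volume E ≤ 64 * ∫⁻ z in S, ‖f z‖ₑ ∧
    ∫⁻ z in Eᶜ, ‖kernelConv (regBeurling ε) (fun w => S.indicator f w - g w) z‖ₑ ≤
      2 * hormanderConst * ∫⁻ z in S, ‖f z‖ₑ

namespace HasCZDecomposition

variable {ε α : ℝ} {f : ℂ → ℂ} {S S' : Set ℂ}

lemma of_norm_le (hS : MeasurableSet S) (hf : Measurable f) (hα : 0 < α)
    (h : ∀ z ∈ S, ‖f z‖ ≤ 4 * α) : HasCZDecomposition ε α f S := by
  refine ⟨S.indicator f, ∅, hf.indicator hS, MeasurableSet.empty,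
    fun z hz => Set.indicator_of_notMem hz f, fun z => ?_, ?_, by simp, ?_⟩
  · by_cases hz : z ∈ S
    · simpa [hz] using h z hz
    · simpa [hz] using hα.le
  · simp only [enorm_indicator_eq_indicator_enorm, lintegral_indicator hS, le_refl]
  · simp [kernelConv]

lemma integrable_of_lintegral_le {g : ℂ → ℂ} (hg : Measurable g) (hfi : IntegrableOn f S)
    (h : ∫⁻ z, ‖g z‖ₑ ≤ ∫⁻ z in S, ‖f z‖ₑ) : Integrable g :=
  ⟨hg.aestronglyMeasurable, h.trans_lt hfi.2⟩

lemma union (hε : 0 < ε) (hS : MeasurableSet S) (hS' : MeasurableSet S')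
    (hd : Disjoint S S') (hfi : IntegrableOn f S) (hfi' : IntegrableOn f S')
    (h : HasCZDecomposition ε α f S) (h' : HasCZDecomposition ε α f S') :
    HasCZDecomposition ε α f (S ∪ S') := by
  obtain ⟨g, E, hg, hE, h0, hle, hle₁, hvol, hT⟩ := h
  obtain ⟨g', E', hg', hE', h0', hle', hle₁', hvol', hT'⟩ := h'
  have hgi := integrable_of_lintegral_le hg hfi hle₁
  have hgi' := integrable_of_lintegral_le hg' hfi' hle₁'
  have hu : ∫⁻ z in S ∪ S', ‖f z‖ₑ = (∫⁻ z in S, ‖f z‖ₑ) + ∫⁻ z in S', ‖f z‖ₑ :=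
    lintegral_union hS' hd
  refine ⟨fun z => g z + g' z, E ∪ E', hg.add hg', hE.union hE', fun z hz => ?_, fun z => ?_,
    ?_, ?_, ?_⟩
  · rw [Set.mem_union, not_or] at hz
    simp [h0 z hz.1, h0' z hz.2]
  · by_cases hz : z ∈ S
    · simpa [h0' z (hd.notMem_of_mem_left hz)] using hle z
    · simpa [h0 z hz] using hle' z
  · rw [hu]
    refine (lintegral_mono fun z => enorm_add_le _ _).trans ?_
    rw [lintegral_add_left (by fun_prop)]
    exact add_le_add hle₁ hle₁'
  · rw [hu, mul_add]
    refine (mul_le_mul_right (measure_union_le E E') _).trans ?_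
    rw [mul_add]
    exact add_le_add hvol hvol'
  · rw [hu, mul_add]
    have hbi : Integrable (fun w => S.indicator f w - g w) :=
      ((integrable_indicator_iff hS).mpr hfi).sub hgi
    have hbi' : Integrable (fun w => S'.indicator f w - g' w) :=
      ((integrable_indicator_iff hS').mpr hfi').sub hgi'
    have hdec := hasDecay_regBeurling hε
    have hk := continuous_regBeurling hε
    have e : (fun w => (S ∪ S').indicator f w - (g w + g' w)) =
        fun w => (S.indicator f w - g w) + (S'.indicator f w - g' w) := by
      ext w
      rw [Set.indicator_union_of_disjoint hd]
      ring
    simp only [e, kernelConv_add hdec hk hbi hbi']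
    refine (lintegral_mono fun z => enorm_add_le _ _).trans ?_
    rw [lintegral_add_left (continuous_kernelConv hdec hk hbi).measurable.enorm]
    refine add_le_add (le_trans ?_ hT) (le_trans ?_ hT')
    · exact lintegral_mono_set (Set.compl_subset_compl.mpr Set.subset_union_left)
    · exact lintegral_mono_set (Set.compl_subset_compl.mpr Set.subset_union_right)

lemma of_lintegral_between (hε : 0 < ε) (hα : 0 < α) (hS : MeasurableSet S)
    (hfi : IntegrableOn f S) {c : ℂ} {r : ℝ} (hr : 0 < r) (hSc : S ⊆ Metric.closedBall c r)
    (hS0 : volume S ≠ 0)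
    (hvol : volume (Metric.closedBall c (2 * r)) ≤ 64 * volume S)
    (hlow : ENNReal.ofReal α * volume S ≤ ∫⁻ z in S, ‖f z‖ₑ)
    (hup : ∫⁻ z in S, ‖f z‖ₑ ≤ 4 * ENNReal.ofReal α * volume S) :
    HasCZDecomposition ε α f S := by
  have hStop : volume S ≠ ∞ :=
    ((measure_mono hSc).trans_lt measure_closedBall_lt_top).ne
  have : IsFiniteMeasure (volume.restrict S) := ⟨by simpa using hStop.lt_top⟩
  have hmul : ‖⨍ z in S, f z‖ₑ * volume S ≤ ∫⁻ z in S, ‖f z‖ₑ := by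
    have hv : volume S = ‖(volume.real S : ℂ)‖ₑ := by
      rw [← ofReal_norm, Complex.norm_real, Real.norm_of_nonneg measureReal_nonneg,
        ofReal_measureReal hStop]
    have h := measure_smul_setAverage (μ := volume) f hStop
    rw [hv, ← enorm_mul, mul_comm, ← Complex.real_smul, h]
    exact enorm_integral_le_lintegral_enorm _
  have havg : ‖⨍ z in S, f z‖ ≤ 4 * α := by
    have h := (ENNReal.mul_le_mul_iff_left hS0 hStop).mp (hmul.trans hup)
    rw [← ofReal_norm, ← ENNReal.ofReal_ofNat, ← ENNReal.ofReal_mul (by norm_num)] at h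
    exact (ENNReal.ofReal_le_ofReal_iff (by positivity)).mp h
  have hg : Measurable (S.indicator fun _ => ⨍ z in S, f z) := measurable_const.indicator hS
  have hle₁ : ∫⁻ z, ‖S.indicator (fun _ => ⨍ z in S, f z) z‖ₑ ≤ ∫⁻ z in S, ‖f z‖ₑ := by
    simp only [enorm_indicator_eq_indicator_enorm, lintegral_indicator hS, setLIntegral_const]
    exact hmul
  have hgi := integrable_of_lintegral_le hg hfi hle₁
  have hfi' := (integrable_indicator_iff hS).mpr hfi
  refine ⟨S.indicator fun _ => ⨍ z in S, f z, Metric.closedBall c (2 * r), hg,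
    Metric.isClosed_closedBall.measurableSet, fun z hz => Set.indicator_of_notMem hz _,
    fun z => ?_, hle₁, ?_, ?_⟩
  · by_cases hz : z ∈ S
    · simpa [hz] using havg
    · simpa [hz] using hα.le
  · calc _ ≤ ENNReal.ofReal α * (64 * volume S) := by gcongr
      _ = 64 * (ENNReal.ofReal α * volume S) := by ring
      _ ≤ _ := by gcongr
  · refine (lintegral_compl_regBeurling_conv_le hε (hfi'.sub hgi) hr (fun w hw => ?_) ?_).trans ?_
    · have : w ∉ S := fun h => hw (hSc h)
      simp [this]
    · rw [integral_sub' hfi' hgi, integral_indicator hS, integral_indicator hS, setIntegral_const,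
        measure_smul_setAverage f hStop, sub_self]
    · rw [mul_comm 2, mul_assoc]
      gcongr
      refine (lintegral_mono fun z => enorm_sub_le).trans ?_
      rw [lintegral_add_right _ hg.enorm, two_mul]
      refine add_le_add (le_of_eq ?_) hle₁
      simp only [enorm_indicator_eq_indicator_enorm, lintegral_indicator hS]

end HasCZDecomposition

/-- The half-open square with lower left corner `a` and side length `s`. -/
def hoSquare (a : ℂ) (s : ℝ) : Set ℂ :=
  Set.Ico a.re (a.re + s) ×ℂ Set.Ico a.im (a.im + s)

lemma measurableSet_hoSquare (a : ℂ) (s : ℝ) : MeasurableSet (hoSquare a s) :=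
  (Complex.measurable_re measurableSet_Ico).inter (Complex.measurable_im measurableSet_Ico)

lemma volume_hoSquare (a : ℂ) (s : ℝ) :
    volume (hoSquare a s) = ENNReal.ofReal s * ENNReal.ofReal s := by
  have h := Complex.volume_preserving_equiv_real_prod.measure_preimage
    (s := Set.Ico a.re (a.re + s) ×ˢ Set.Ico a.im (a.im + s))
    (measurableSet_Ico.prod measurableSet_Ico).nullMeasurableSet
  rw [Measure.volume_eq_prod, Measure.prod_prod, Real.volume_Ico, Real.volume_Ico,
    add_sub_cancel_left, add_sub_cancel_left] at h
  exact h

lemma mem_hoSquare {a : ℂ} {s : ℝ} {z : ℂ} : z ∈ hoSquare a s ↔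
    (a.re ≤ z.re ∧ z.re < a.re + s) ∧ (a.im ≤ z.im ∧ z.im < a.im + s) := Iff.rfl

lemma dist_le_of_mem_hoSquare {a z w : ℂ} {s : ℝ} (hz : z ∈ hoSquare a s)
    (hw : w ∈ hoSquare a s) : dist z w ≤ 2 * s := by
  rw [mem_hoSquare] at hz hw
  rw [dist_eq_norm]
  refine (Complex.norm_le_abs_re_add_abs_im _).trans ?_
  rw [Complex.sub_re, Complex.sub_im]
  have h1 : |z.re - w.re| ≤ s := abs_le.mpr ⟨by linarith, by linarith⟩
  have h2 : |z.im - w.im| ≤ s := abs_le.mpr ⟨by linarith, by linarith⟩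
  linarith

lemma hoSquare_subset_closedBall {a : ℂ} {s : ℝ} : hoSquare a s ⊆ Metric.closedBall a (2 * s) := by
  intro z hz
  have hs : 0 < s := by
    rw [mem_hoSquare] at hz
    linarith
  exact dist_le_of_mem_hoSquare hz (mem_hoSquare.mpr (by simp [hs]))

lemma Continuous.integrableOn_hoSquare {E : Type*} [NormedAddCommGroup E] {f : ℂ → E}
    (hf : Continuous f) (a : ℂ) (s : ℝ) :
    IntegrableOn f (hoSquare a s) :=
  (hf.continuousOn.integrableOn_compact (isCompact_closedBall a (2 * s))).mono_set
    hoSquare_subset_closedBall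

lemma hoSquare_two_mul (a : ℂ) {s : ℝ} (hs : 0 < s) :
    hoSquare a (2 * s) = (hoSquare a s ∪ hoSquare (a + s) s) ∪
      (hoSquare (a + s * Complex.I) s ∪ hoSquare (a + s + s * Complex.I) s) := by
  ext z
  simp only [Set.mem_union, mem_hoSquare, Complex.add_re, Complex.add_im, Complex.ofReal_re,
    Complex.ofReal_im, Complex.mul_re, Complex.mul_im, Complex.I_re, Complex.I_im]
  constructor
  · intro h
    rcases lt_or_ge z.re (a.re + s) with h1 | h1 <;> rcases lt_or_ge z.im (a.im + s) with h2 | h2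
    · left; left; constructor <;> constructor <;> linarith
    · right; left; constructor <;> constructor <;> linarith
    · left; right; constructor <;> constructor <;> linarith
    · right; right; constructor <;> constructor <;> linarith
  · rintro ((h | h) | (h | h)) <;> constructor <;> constructor <;> linarith

lemma hasCZDecomposition_hoSquare {ε α : ℝ} (hε : 0 < ε) (hα : 0 < α) {f : ℂ → ℂ}
    (hf : Continuous f) (n : ℕ) (a : ℂ) {s : ℝ} (hs : 0 < s)
    (hmean : ∫⁻ z in hoSquare a s, ‖f z‖ₑ ≤ ENNReal.ofReal α * volume (hoSquare a s))
    (hosc : ∀ z ∈ hoSquare a s, ∀ w ∈ hoSquare a s, dist z w ≤ 2 * s / 2 ^ n →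
      ‖f z - f w‖ ≤ α) : HasCZDecomposition ε α f (hoSquare a s) := by
  have hvol : ∀ (a : ℂ) {s : ℝ}, 0 < s → volume (hoSquare a s) ≠ 0 := fun a s hs => by
    simp [volume_hoSquare, hs]
  have hvol' : ∀ (a : ℂ) (s : ℝ), volume (hoSquare a s) ≠ ∞ := fun a s => by
    rw [volume_hoSquare]
    exact ENNReal.mul_ne_top ENNReal.ofReal_ne_top ENNReal.ofReal_ne_top
  induction n generalizing a s with
  | zero =>
    refine .of_norm_le (measurableSet_hoSquare a s) hf.measurable hα fun z hz => ?_
    have h1 : ∀ w ∈ hoSquare a s, ‖f z‖ₑ ≤ ‖f w‖ₑ + ENNReal.ofReal α := fun w hw => by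
      have := hosc z hz w hw (by simpa using dist_le_of_mem_hoSquare hz hw)
      rw [← ofReal_norm, ← ofReal_norm, ← ENNReal.ofReal_add (norm_nonneg _) hα.le]
      refine ENNReal.ofReal_le_ofReal ?_
      linarith [norm_le_norm_add_norm_sub (f w) (f z), norm_sub_rev (f w) (f z)]
    have h2 := setLIntegral_mono' (μ := volume) (measurableSet_hoSquare a s) h1
    rw [setLIntegral_const, lintegral_add_right _ measurable_const, setLIntegral_const] at h2
    have h3 := h2.trans (add_le_add_left hmean _)
    rw [← add_mul, ENNReal.mul_le_mul_iff_left (hvol a hs) (hvol' a s),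
      ← ENNReal.ofReal_add hα.le hα.le, ← ofReal_norm,
      ENNReal.ofReal_le_ofReal_iff (by positivity)] at h3
    linarith
  | succ n ih =>
    obtain ⟨t, rfl⟩ : ∃ t, s = 2 * t := ⟨s / 2, by ring⟩
    have ht : 0 < t := by linarith
    have hv4 : ∀ b, volume (hoSquare a (2 * t)) = 4 * volume (hoSquare b t) := fun b => by
      rw [volume_hoSquare, volume_hoSquare, ENNReal.ofReal_mul (by norm_num), ENNReal.ofReal_ofNat]
      ring
    have hchild : ∀ b, hoSquare b t ⊆ hoSquare a (2 * t) →
        HasCZDecomposition ε α f (hoSquare b t) := fun b hb => by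
      rcases le_total (∫⁻ z in hoSquare b t, ‖f z‖ₑ)
        (ENNReal.ofReal α * volume (hoSquare b t)) with h | h
      · refine ih b ht h fun z hz w hw hzw => hosc z (hb hz) w (hb hw) (hzw.trans_eq ?_)
        rw [pow_succ]
        field_simp
      · refine .of_lintegral_between hε hα (measurableSet_hoSquare b t)
          (hf.integrableOn_hoSquare b t) (c := b) (r := 2 * t) (by positivity)
          hoSquare_subset_closedBall (hvol b ht) ?_ h ?_
        · rw [Complex.volume_closedBall, volume_hoSquare]
          have hpi : (NNReal.pi : ℝ≥0∞) ≤ 4 := by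
            have : NNReal.pi ≤ 4 := Real.pi_le_four
            exact_mod_cast this
          rw [show 2 * (2 * t) = 4 * t by ring, ENNReal.ofReal_mul (by norm_num),
            ENNReal.ofReal_ofNat]
          calc _ ≤ (4 * ENNReal.ofReal t) ^ 2 * 4 := by gcongr
            _ = _ := by ring
        · refine (lintegral_mono_set hb).trans (hmean.trans_eq ?_)
          rw [hv4 b]
          ring
    have hsq := hoSquare_two_mul a ht
    have hms := measurableSet_hoSquare
    have hle₁ := fun b => hf.integrableOn_hoSquare b t
    have hdisj : ∀ {b c : ℂ}, (b.re + t ≤ c.re ∨ b.im + t ≤ c.im) →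
        Disjoint (hoSquare b t) (hoSquare c t) := fun {b c} h => by
      rw [Set.disjoint_left]
      intro z hz hz'
      rw [mem_hoSquare] at hz hz'
      rcases h with h | h <;> linarith
    rw [hsq] at hchild ⊢
    refine .union hε ((hms _ _).union (hms _ _)) ((hms _ _).union (hms _ _)) ?_
      ((hle₁ _).union (hle₁ _)) ((hle₁ _).union (hle₁ _))
      (.union hε (hms _ _) (hms _ _) (hdisj (by simp)) (hle₁ _) (hle₁ _)
        (hchild _ fun _ h => Or.inl (Or.inl h)) (hchild _ fun _ h => Or.inl (Or.inr h)))
      (.union hε (hms _ _) (hms _ _) (hdisj (by simp)) (hle₁ _) (hle₁ _)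
        (hchild _ fun _ h => Or.inr (Or.inl h)) (hchild _ fun _ h => Or.inr (Or.inr h)))
    rw [Set.disjoint_union_left, Set.disjoint_union_right, Set.disjoint_union_right]
    exact ⟨⟨hdisj (by simp), hdisj (by simp)⟩, ⟨hdisj (by simp), hdisj (by simp)⟩⟩

/-- The square `[-1, 1)²`. -/
def unitSquare : Set ℂ := hoSquare (-1 - Complex.I) 2

/-- The regularised Beurling transform of the restriction of `f` to the square `[-1, 1)²`. -/
noncomputable def squareBeurling (ε : ℝ) (f : ℂ → ℂ) : ℂ → ℂ :=
  kernelConv (regBeurling ε) (unitSquare.indicator f)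

lemma measurableSet_unitSquare : MeasurableSet unitSquare := measurableSet_hoSquare _ _

lemma Continuous.integrable_indicator_unitSquare {f : ℂ → ℂ} (hf : Continuous f) :
    Integrable (unitSquare.indicator f) :=
  (integrable_indicator_iff measurableSet_unitSquare).mpr (hf.integrableOn_hoSquare _ _)

lemma continuous_squareBeurling {ε : ℝ} (hε : 0 < ε) {f : ℂ → ℂ} (hf : Continuous f) :
    Continuous (squareBeurling ε f) :=
  continuous_kernelConv (hasDecay_regBeurling hε) (continuous_regBeurling hε)
    hf.integrable_indicator_unitSquare

/-- The constant in the weak-type estimate. -/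
noncomputable def weakConst : ℝ≥0∞ :=
  64 + 2 * hormanderConst + 8 * (∫⁻ z, ‖regDelta 1 z‖ₑ) ^ 2

lemma lintegral_regDelta_one_ne_top : ∫⁻ z, ‖regDelta 1 z‖ₑ ≠ ∞ :=
  ((hasDecay_four_regDelta one_pos).integrable (by norm_num) (continuous_regDelta one_pos)).2.ne

lemma weakConst_ne_top : weakConst ≠ ∞ := by
  unfold weakConst
  refine ENNReal.add_ne_top.mpr ⟨ENNReal.add_ne_top.mpr ⟨by simp, ?_⟩, ?_⟩
  · exact ENNReal.mul_ne_top (by simp) ENNReal.ofReal_ne_top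
  · exact ENNReal.mul_ne_top (by simp) (ENNReal.pow_ne_top lintegral_regDelta_one_ne_top)

lemma exists_hasCZDecomposition_unitSquare {ε α : ℝ} (hε : 0 < ε) (hα : 0 < α) {f : ℂ → ℂ}
    (hf : Continuous f)
    (hmean : ∫⁻ z in unitSquare, ‖f z‖ₑ ≤ ENNReal.ofReal α * volume unitSquare) :
    HasCZDecomposition ε α f unitSquare := by
  have hu := (isCompact_closedBall (-1 - Complex.I) (2 * 2 : ℝ)).uniformContinuousOn_of_continuous
    hf.continuousOn
  obtain ⟨δ, hδ, h⟩ := Metric.uniformContinuousOn_iff_le.mp hu α hα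
  obtain ⟨n, hn⟩ := exists_pow_lt_of_lt_one (show 0 < δ / 4 by positivity)
    (show (1 / 2 : ℝ) < 1 by norm_num)
  refine hasCZDecomposition_hoSquare hε hα hf n _ two_pos hmean fun z hz w hw hzw => ?_
  rw [← dist_eq_norm]
  refine h z (hoSquare_subset_closedBall hz) w (hoSquare_subset_closedBall hw) (hzw.trans ?_)
  rw [one_div, inv_pow] at hn
  rw [div_eq_mul_inv]
  linarith

/-- The height-`α` truncation of `f`. -/
noncomputable def truncation (α : ℝ) (f : ℂ → ℂ) (z : ℂ) : ℂ := (α / max α ‖f z‖ : ℝ) * f z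

lemma continuous_truncation {α : ℝ} (hα : 0 < α) {f : ℂ → ℂ} (hf : Continuous f) :
    Continuous (truncation α f) := by
  unfold truncation
  refine Continuous.mul (Complex.continuous_ofReal.comp ?_) hf
  exact continuous_const.div (by fun_prop) fun z => (lt_max_of_lt_left hα).ne'

lemma norm_truncation {α : ℝ} (hα : 0 < α) (f : ℂ → ℂ) (z : ℂ) :
    ‖truncation α f z‖ = min ‖f z‖ α := by
  have hm : 0 < max α ‖f z‖ := lt_max_of_lt_left hα
  rw [truncation, norm_mul, Complex.norm_real, Real.norm_of_nonneg (by positivity)]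
  rcases le_total α ‖f z‖ with h | h
  · rw [max_eq_right h] at hm ⊢
    rw [min_eq_right h]
    field_simp
  · rw [max_eq_left h, min_eq_left h]
    field_simp

lemma norm_sub_truncation {α : ℝ} (hα : 0 < α) (f : ℂ → ℂ) (z : ℂ) :
    ‖f z - truncation α f z‖ = max (‖f z‖ - α) 0 := by
  have hm : 0 < max α ‖f z‖ := lt_max_of_lt_left hα
  have e : f z - truncation α f z = ((1 - α / max α ‖f z‖ : ℝ) : ℂ) * f z := by
    rw [truncation]
    push_cast
    ring
  rw [e, norm_mul, Complex.norm_real, Real.norm_of_nonneg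
    (sub_nonneg.mpr ((div_le_one hm).mpr (le_max_left _ _)))]
  rcases le_total α ‖f z‖ with h | h
  · rw [max_eq_right h] at hm ⊢
    rw [max_eq_left (by linarith)]
    field_simp
  · rw [max_eq_left h, max_eq_right (by linarith), div_self hα.ne']
    simp

/-- The integrand in the weak-type estimate at height `t` for a function of absolute value `s`. -/
noncomputable def weakProfile (s t : ℝ) : ℝ := max (s - t) 0 * t + min s t ^ 2

lemma lintegral_weakProfile {α : ℝ} (hα : 0 < α) {f : ℂ → ℂ} (hf : Continuous f) :
    ∫⁻ z in unitSquare, ENNReal.ofReal (weakProfile ‖f z‖ α) =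
      ENNReal.ofReal α * (∫⁻ z in unitSquare, ‖f z - truncation α f z‖ₑ) +
        ∫⁻ z in unitSquare, ‖truncation α f z‖ₑ ^ 2 := by
  have hc := continuous_truncation hα hf
  rw [← lintegral_const_mul _ (by fun_prop), ← lintegral_add_left (by fun_prop)]
  congr 1
  ext z
  rw [← ofReal_norm, ← ofReal_norm, norm_truncation hα, norm_sub_truncation hα,
    ← ENNReal.ofReal_mul hα.le, ← ENNReal.ofReal_pow (by positivity),
    ← ENNReal.ofReal_add (by positivity) (by positivity), weakProfile, mul_comm α]

lemma weak_type_of_decomposition {ε α : ℝ} (hε : 0 < ε) (hα : 0 < α) {f : ℂ → ℂ}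
    (hf : Continuous f)
    (h : HasCZDecomposition ε α (fun z => f z - truncation α f z) unitSquare) :
    ENNReal.ofReal α ^ 2 * volume {z | 2 * α < ‖squareBeurling ε f z‖} ≤
      weakConst * ∫⁻ z in unitSquare, ENNReal.ofReal (weakProfile ‖f z‖ α) := by
  obtain ⟨g, E, hg, hE, -, hle, hle₁, hvol, hT⟩ := h
  have hc := continuous_truncation hα hf
  have hf1 : Continuous fun z => f z - truncation α f z := hf.sub hc
  have hgi := HasCZDecomposition.integrable_of_lintegral_le hg
    (hf1.integrableOn_hoSquare _ _) hle₁
  have hdec := hasDecay_regBeurling hε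
  have hk := continuous_regBeurling hε
  rw [lintegral_weakProfile hα hf]
  set a := ENNReal.ofReal α with ha
  set I₁ := ∫⁻ z in unitSquare, ‖f z - truncation α f z‖ₑ
  set I₂ := ∫⁻ z in unitSquare, ‖truncation α f z‖ₑ ^ 2
  set b : ℂ → ℂ := fun w => unitSquare.indicator (fun z => f z - truncation α f z) w - g w
  set h : ℂ → ℂ := fun w => g w + unitSquare.indicator (truncation α f) w
  have hbi : Integrable b := hf1.integrable_indicator_unitSquare.sub hgi
  have hhi : Integrable h := hgi.add hc.integrable_indicator_unitSquare
  have hhm : Measurable h := hg.add (hc.measurable.indicator measurableSet_unitSquare)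
  have hsplit : ∀ z, squareBeurling ε f z =
      kernelConv (regBeurling ε) b z + kernelConv (regBeurling ε) h z := fun z => by
    rw [← kernelConv_add hdec hk hbi hhi, squareBeurling]
    congr 1
    ext w
    by_cases hw : w ∈ unitSquare
    · simp only [b, h, Set.indicator_of_mem hw]
      ring
    · simp [b, h, hw]
  have hsub : {z | 2 * α < ‖squareBeurling ε f z‖} ⊆
      (E ∪ (Eᶜ ∩ {z | a ≤ ‖kernelConv (regBeurling ε) b z‖ₑ})) ∪
        {z | a ^ 2 ≤ ‖kernelConv (regBeurling ε) h z‖ₑ ^ 2} := by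
    intro z hz
    by_contra hcon
    simp only [Set.mem_union, Set.mem_inter_iff, Set.mem_compl_iff, Set.mem_ofPred_eq, not_or,
      not_and, not_le] at hcon hz
    have h1 := hcon.1.2 hcon.1.1
    have h2 := lt_of_pow_lt_pow_left' 2 hcon.2
    rw [ha, ← ofReal_norm, ENNReal.ofReal_lt_ofReal_iff hα] at h1 h2
    have := norm_add_le (kernelConv (regBeurling ε) b z) (kernelConv (regBeurling ε) h z)
    rw [← hsplit] at this
    linarith
  have hb1 : a * volume (Eᶜ ∩ {z | a ≤ ‖kernelConv (regBeurling ε) b z‖ₑ}) ≤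
      2 * hormanderConst * I₁ := by
    have hm := (continuous_kernelConv hdec hk hbi).measurable.enorm
    refine le_trans ?_ hT
    have := mul_meas_ge_le_lintegral (μ := volume.restrict Eᶜ) hm a
    rwa [Measure.restrict_apply (measurableSet_le measurable_const hm), Set.inter_comm] at this
  have hh1 : a ^ 2 * volume {z | a ^ 2 ≤ ‖kernelConv (regBeurling ε) h z‖ₑ ^ 2} ≤
      (∫⁻ z, ‖regDelta 1 z‖ₑ) ^ 2 * ∫⁻ z, ‖h z‖ₑ ^ 2 :=
    (mul_meas_ge_le_lintegral ((continuous_kernelConv hdec hk hhi).measurable.enorm.pow_const 2)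
      _).trans (lintegral_sq_regBeurling_conv_le hε hhm hhi)
  have hh2 : ∫⁻ z, ‖h z‖ₑ ^ 2 ≤ 8 * (a * I₁ + I₂) := by
    have hp : ∀ z, ‖h z‖ₑ ^ 2 ≤
        8 * a * ‖g z‖ₑ + 2 * unitSquare.indicator (fun z => ‖truncation α f z‖ₑ ^ 2) z := by
      intro z
      have e : unitSquare.indicator (fun z => ‖truncation α f z‖ₑ ^ 2) z =
          ‖unitSquare.indicator (truncation α f) z‖ₑ ^ 2 := by
        by_cases hz : z ∈ unitSquare <;> simp [hz]
      rw [e, ha, ← ofReal_norm, ← ofReal_norm, ← ofReal_norm, ← ENNReal.ofReal_ofNat 8,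
        ← ENNReal.ofReal_ofNat 2, ← ENNReal.ofReal_mul (by norm_num),
        ← ENNReal.ofReal_mul (by positivity), ← ENNReal.ofReal_pow (norm_nonneg _),
        ← ENNReal.ofReal_pow (norm_nonneg _), ← ENNReal.ofReal_mul (by norm_num),
        ← ENNReal.ofReal_add (by positivity) (by positivity)]
      refine ENNReal.ofReal_le_ofReal ?_
      have h1 := norm_add_le (g z) (unitSquare.indicator (truncation α f) z)
      have h2 := pow_le_pow_left₀ (norm_nonneg _) h1 2
      nlinarith [sq_nonneg (‖g z‖ - ‖unitSquare.indicator (truncation α f) z‖),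
        mul_le_mul_of_nonneg_right (hle z) (norm_nonneg (g z))]
    refine (lintegral_mono hp).trans ?_
    rw [lintegral_add_left (by fun_prop), lintegral_const_mul _ (by fun_prop),
      lintegral_const_mul' _ _ (by simp), lintegral_indicator measurableSet_unitSquare, mul_add,
      mul_assoc]
    gcongr
    norm_num
  calc a ^ 2 * volume {z | 2 * α < ‖squareBeurling ε f z‖}
      ≤ a ^ 2 * (volume E + volume (Eᶜ ∩ {z | a ≤ ‖kernelConv (regBeurling ε) b z‖ₑ}) +
        volume {z | a ^ 2 ≤ ‖kernelConv (regBeurling ε) h z‖ₑ ^ 2}) := by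
        gcongr
        refine (measure_mono hsub).trans ((measure_union_le _ _).trans ?_)
        gcongr
        exact measure_union_le _ _
    _ = a * (a * volume E) +
          a * (a * volume (Eᶜ ∩ {z | a ≤ ‖kernelConv (regBeurling ε) b z‖ₑ})) +
        a ^ 2 * volume {z | a ^ 2 ≤ ‖kernelConv (regBeurling ε) h z‖ₑ ^ 2} := by ring
    _ ≤ a * (64 * I₁) + a * (2 * hormanderConst * I₁) +
        (∫⁻ z, ‖regDelta 1 z‖ₑ) ^ 2 * (8 * (a * I₁ + I₂)) := by
        exact add_le_add (add_le_add (by gcongr) (by gcongr)) (hh1.trans (by gcongr))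
    _ = 64 * (a * I₁) + 2 * hormanderConst * (a * I₁) +
        8 * (∫⁻ z, ‖regDelta 1 z‖ₑ) ^ 2 * (a * I₁ + I₂) := by ring
    _ ≤ 64 * (a * I₁ + I₂) + 2 * hormanderConst * (a * I₁ + I₂) +
        8 * (∫⁻ z, ‖regDelta 1 z‖ₑ) ^ 2 * (a * I₁ + I₂) := by
        gcongr <;> exact le_self_add
    _ = _ := by rw [weakConst]; ring

lemma weak_type {ε α : ℝ} (hε : 0 < ε) (hα : 0 < α) {f : ℂ → ℂ} (hf : Continuous f) :
    ENNReal.ofReal α ^ 2 * volume.restrict unitSquare {z | 2 * α < ‖squareBeurling ε f z‖} ≤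
      weakConst * ∫⁻ z in unitSquare, ENNReal.ofReal (weakProfile ‖f z‖ α) := by
  have hf1 : Continuous fun z => f z - truncation α f z := hf.sub (continuous_truncation hα hf)
  rcases le_total (∫⁻ z in unitSquare, ‖f z - truncation α f z‖ₑ)
    (ENNReal.ofReal α * volume unitSquare) with h | h
  · refine le_trans ?_ (weak_type_of_decomposition hε hα hf
      (exists_hasCZDecomposition_unitSquare hε hα hf1 h))
    gcongr
    exact Measure.restrict_le_self
  · rw [lintegral_weakProfile hα hf]
    have h1 : (1 : ℝ≥0∞) ≤ weakConst := by
      unfold weakConst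
      rw [add_assoc]
      exact le_add_right (by norm_num)
    calc _ ≤ ENNReal.ofReal α ^ 2 * volume unitSquare := by
          exact mul_le_mul' le_rfl
            ((measure_mono (Set.subset_univ _)).trans_eq (Measure.restrict_apply_univ _))
      _ = 1 * (ENNReal.ofReal α * (ENNReal.ofReal α * volume unitSquare)) := by ring
      _ ≤ weakConst * (ENNReal.ofReal α * (∫⁻ z in unitSquare, ‖f z - truncation α f z‖ₑ)) := by
          gcongr
      _ ≤ _ := by
          gcongr
          exact le_self_add

lemma lintegral_weakProfile_rpow {p : ℝ} (hp : 1 < p) (hp2 : p < 2) {s : ℝ} (hs : 0 ≤ s) :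
    ∫⁻ t in Set.Ioi (0 : ℝ), ENNReal.ofReal (weakProfile s t) * ENNReal.ofReal (t ^ (p - 3)) =
      ENNReal.ofReal ((p - 1)⁻¹ + (2 - p)⁻¹) * ENNReal.ofReal (s ^ p) := by
  rcases hs.eq_or_lt with rfl | hs
  · rw [Real.zero_rpow (by linarith), ENNReal.ofReal_zero, mul_zero]
    refine setLIntegral_eq_zero measurableSet_Ioi fun t ht => ?_
    rw [Set.mem_Ioi] at ht
    simp [weakProfile, ht.le]
  have h1 : ∫⁻ t in Set.Ioc 0 s,
      ENNReal.ofReal (weakProfile s t) * ENNReal.ofReal (t ^ (p - 3)) =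
      ENNReal.ofReal ((p - 1)⁻¹ * s ^ p) := by
    have hi : IntegrableOn (fun t : ℝ => s * t ^ (p - 2)) (Set.Ioc 0 s) :=
      ((intervalIntegrable_iff_integrableOn_Ioc_of_le hs.le).mp
        (intervalIntegral.intervalIntegrable_rpow' (by linarith))).const_mul s
    have hv : ∫ t in Set.Ioc 0 s, s * t ^ (p - 2) = (p - 1)⁻¹ * s ^ p := by
      rw [integral_const_mul, ← intervalIntegral.integral_of_le hs.le,
        integral_rpow (Or.inl (by linarith)), Real.zero_rpow (by linarith),
        show p - 2 + 1 = p - 1 by ring, Real.rpow_sub_one hs.ne']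
      field_simp
      ring
    rw [← hv, ofReal_integral_eq_lintegral_ofReal hi]
    · refine setLIntegral_congr_fun measurableSet_Ioc fun t ht => ?_
      have ht0 := ht.1
      rw [← ENNReal.ofReal_mul (by unfold weakProfile; positivity), weakProfile,
        max_eq_left (by linarith [ht.2]), min_eq_right ht.2,
        show p - 3 = p - 2 - 1 by ring, Real.rpow_sub_one ht0.ne']
      congr 1
      field_simp
      ring
    · filter_upwards [ae_restrict_mem measurableSet_Ioc] with t ht
      have := ht.1
      positivity
  have h2 : ∫⁻ t in Set.Ioi s,
      ENNReal.ofReal (weakProfile s t) * ENNReal.ofReal (t ^ (p - 3)) =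
      ENNReal.ofReal ((2 - p)⁻¹ * s ^ p) := by
    have hi : IntegrableOn (fun t : ℝ => s ^ 2 * t ^ (p - 3)) (Set.Ioi s) :=
      (integrableOn_Ioi_rpow_of_lt (by linarith) hs).const_mul _
    have hv : ∫ t in Set.Ioi s, s ^ 2 * t ^ (p - 3) = (2 - p)⁻¹ * s ^ p := by
      rw [integral_const_mul, integral_Ioi_rpow_of_lt (by linarith) hs,
        show p - 3 + 1 = p - 2 by ring, Real.rpow_sub hs, Real.rpow_two]
      have : p - 2 ≠ 0 := by linarith
      have : 2 - p ≠ 0 := by linarith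
      field_simp
      ring
    rw [← hv, ofReal_integral_eq_lintegral_ofReal hi]
    · refine setLIntegral_congr_fun measurableSet_Ioi fun t ht => ?_
      rw [Set.mem_Ioi] at ht
      have ht0 := hs.trans ht
      rw [← ENNReal.ofReal_mul (by unfold weakProfile; positivity), weakProfile,
        max_eq_right (by linarith), min_eq_left ht.le, zero_mul, zero_add]
    · filter_upwards [ae_restrict_mem measurableSet_Ioi] with t ht
      have := hs.trans ht
      positivity
  have hp1 : 0 < p - 1 := by linarith
  have hp3 : 0 < 2 - p := by linarith
  rw [← Set.Ioc_union_Ioi_eq_Ioi hs.le, lintegral_union measurableSet_Ioi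
    (Set.Ioc_disjoint_Ioi le_rfl), h1, h2, ← ENNReal.ofReal_add (by positivity) (by positivity),
    ← ENNReal.ofReal_mul (by positivity), add_mul]

lemma continuous_weakProfile : Continuous fun q : ℝ × ℝ => weakProfile q.1 q.2 := by
  unfold weakProfile
  fun_prop

/-- The constant in the strong-type estimate for `1 < p < 2`. -/
noncomputable def strongConst (p : ℝ) : ℝ≥0∞ :=
  ENNReal.ofReal (2 ^ p) * (ENNReal.ofReal p *
    (weakConst * ENNReal.ofReal ((p - 1)⁻¹ + (2 - p)⁻¹)))

lemma strongConst_ne_top (p : ℝ) : strongConst p ≠ ∞ :=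
  ENNReal.mul_ne_top ENNReal.ofReal_ne_top (ENNReal.mul_ne_top ENNReal.ofReal_ne_top
    (ENNReal.mul_ne_top weakConst_ne_top ENNReal.ofReal_ne_top))

lemma lintegral_rpow_squareBeurling_le_of_lt_two {p : ℝ} (hp : 1 < p) (hp2 : p < 2) {ε : ℝ}
    (hε : 0 < ε) {f : ℂ → ℂ} (hf : Continuous f) :
    ∫⁻ z in unitSquare, ENNReal.ofReal (‖squareBeurling ε f z‖ ^ p) ≤
      strongConst p * ∫⁻ z in unitSquare, ENNReal.ofReal (‖f z‖ ^ p) := by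
  have hc := continuous_squareBeurling hε hf
  have hm : ∀ z, ENNReal.ofReal (‖squareBeurling ε f z‖ ^ p) =
      ENNReal.ofReal (2 ^ p) * ENNReal.ofReal ((‖squareBeurling ε f z‖ / 2) ^ p) := fun z => by
    rw [← ENNReal.ofReal_mul (by positivity), ← Real.mul_rpow (by norm_num) (by positivity)]
    congr 2
    ring
  simp only [hm]
  rw [lintegral_const_mul' _ _ ENNReal.ofReal_ne_top,
    lintegral_rpow_eq_lintegral_meas_lt_mul _ (Filter.Eventually.of_forall fun z => by positivity)
      (by fun_prop) (by linarith), strongConst, mul_assoc, mul_assoc, mul_assoc]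
  refine mul_le_mul' le_rfl (mul_le_mul' le_rfl ?_)
  calc ∫⁻ t in Set.Ioi (0 : ℝ), volume.restrict unitSquare {z | t < ‖squareBeurling ε f z‖ / 2} *
        ENNReal.ofReal (t ^ (p - 1))
      ≤ ∫⁻ t in Set.Ioi (0 : ℝ), weakConst * ∫⁻ z in unitSquare,
          ENNReal.ofReal (weakProfile ‖f z‖ t) * ENNReal.ofReal (t ^ (p - 3)) := by
        refine setLIntegral_mono' measurableSet_Ioi fun t ht => ?_
        rw [Set.mem_Ioi] at ht
        have e : ENNReal.ofReal (t ^ (p - 1)) =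
            ENNReal.ofReal t ^ 2 * ENNReal.ofReal (t ^ (p - 3)) := by
          rw [← ENNReal.ofReal_pow ht.le, ← ENNReal.ofReal_mul (by positivity), ← Real.rpow_two,
            ← Real.rpow_add ht]
          congr 2
          ring
        have hset : {z | t < ‖squareBeurling ε f z‖ / 2} =
            {z | 2 * t < ‖squareBeurling ε f z‖} := by
          ext z
          change t < _ / 2 ↔ 2 * t < _
          constructor <;> intro h <;> linarith
        rw [lintegral_mul_const' _ _ ENNReal.ofReal_ne_top, e, hset, ← mul_assoc, ← mul_assoc,
          mul_comm (volume.restrict unitSquare _)]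
        exact mul_le_mul' (weak_type hε ht hf) le_rfl
    _ = weakConst * ∫⁻ z in unitSquare, ∫⁻ t in Set.Ioi (0 : ℝ),
          ENNReal.ofReal (weakProfile ‖f z‖ t) * ENNReal.ofReal (t ^ (p - 3)) := by
        rw [lintegral_const_mul' _ _ weakConst_ne_top, lintegral_lintegral_swap]
        refine Measurable.aemeasurable ?_
        have h1 : Measurable fun q : ℝ × ℂ => weakProfile ‖f q.2‖ q.1 :=
          (continuous_weakProfile.comp (by fun_prop :
            Continuous fun q : ℝ × ℂ => (‖f q.2‖, q.1))).measurable
        exact h1.ennreal_ofReal.mul (measurable_fst.pow_const _).ennreal_ofReal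
    _ = weakConst * (ENNReal.ofReal ((p - 1)⁻¹ + (2 - p)⁻¹) *
          ∫⁻ z in unitSquare, ENNReal.ofReal (‖f z‖ ^ p)) := by
        simp only [lintegral_weakProfile_rpow hp hp2 (norm_nonneg _)]
        rw [lintegral_const_mul' _ _ ENNReal.ofReal_ne_top]
    _ ≤ _ := le_rfl

lemma lintegral_rpow_two_squareBeurling_le {ε : ℝ} (hε : 0 < ε) {f : ℂ → ℂ} (hf : Continuous f) :
    ∫⁻ z in unitSquare, ENNReal.ofReal (‖squareBeurling ε f z‖ ^ (2 : ℝ)) ≤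
      (∫⁻ z, ‖regDelta 1 z‖ₑ) ^ 2 * ∫⁻ z in unitSquare, ENNReal.ofReal (‖f z‖ ^ (2 : ℝ)) := by
  have e : ∀ w : ℂ, ENNReal.ofReal (‖w‖ ^ (2 : ℝ)) = ‖w‖ₑ ^ 2 := fun w => by
    rw [Real.rpow_two, ENNReal.ofReal_pow (norm_nonneg _), ofReal_norm]
  simp only [e]
  refine (setLIntegral_le_lintegral _ _).trans ((lintegral_sq_regBeurling_conv_le hε
    (hf.measurable.indicator measurableSet_unitSquare)
    hf.integrable_indicator_unitSquare).trans_eq ?_)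
  rw [← lintegral_indicator measurableSet_unitSquare]
  congr 2
  ext w
  by_cases hw : w ∈ unitSquare <;> simp [hw]

lemma regBeurling_neg (ε : ℝ) (z : ℂ) : regBeurling ε (-z) = regBeurling ε z := by
  simp [regBeurling, regCauchy]

lemma integral_kernelConv_mul {n : ℕ} {k f g : ℂ → ℂ} (hd : HasDecay n k) (hk : Continuous k)
    (heven : ∀ z, k (-z) = k z) (hf : Integrable f) (hg : Integrable g) :
    ∫ z, kernelConv k f z * g z = ∫ w, f w * kernelConv k g w := by
  obtain ⟨c, hc⟩ := hd.exists_norm_le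
  have hi : Integrable (fun q : ℂ × ℂ => k (q.1 - q.2) * (g q.1 * f q.2))
      (volume.prod volume) :=
    (hg.mul_prod hf).bdd_mul (c := c) (by fun_prop) (Filter.Eventually.of_forall fun q => hc _)
  calc ∫ z, kernelConv k f z * g z = ∫ z, ∫ w, k (z - w) * (g z * f w) := by
        congr 1
        ext z
        rw [kernelConv, ← integral_mul_const]
        congr 1
        ext w
        ring
    _ = ∫ w, ∫ z, k (z - w) * (g z * f w) := integral_integral_swap hi
    _ = ∫ w, f w * kernelConv k g w := by
        congr 1
        ext w
        rw [kernelConv, ← integral_const_mul]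
        congr 1
        ext z
        rw [← heven, neg_sub]
        ring

lemma setIntegral_squareBeurling_mul {ε : ℝ} (hε : 0 < ε) {f g : ℂ → ℂ} (hf : Continuous f)
    (hg : Continuous g) :
    ∫ z in unitSquare, squareBeurling ε f z * g z =
      ∫ w in unitSquare, f w * squareBeurling ε g w := by
  have h := integral_kernelConv_mul (hasDecay_regBeurling hε) (continuous_regBeurling hε)
    (regBeurling_neg ε) hf.integrable_indicator_unitSquare hg.integrable_indicator_unitSquare
  rw [← integral_indicator measurableSet_unitSquare, ← integral_indicator measurableSet_unitSquare]
  have e1 : unitSquare.indicator (fun z => squareBeurling ε f z * g z) =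
      fun z => squareBeurling ε f z * unitSquare.indicator g z := by
    ext z
    by_cases hz : z ∈ unitSquare <;> simp [hz]
  have e2 : unitSquare.indicator (fun w => f w * squareBeurling ε g w) =
      fun w => unitSquare.indicator f w * squareBeurling ε g w := by
    ext w
    by_cases hw : w ∈ unitSquare <;> simp [hw]
  rw [e1, e2]
  exact h

lemma le_rpow_mul_of_le_rpow_mul_rpow {p q : ℝ} (hpq : p.HolderConjugate q) {X A K : ℝ≥0∞}
    (hX : X ≠ ∞) (h : X ≤ A ^ (1 / p) * (K * X) ^ (1 / q)) : X ≤ K ^ (p - 1) * A := by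
  rcases eq_or_ne X 0 with rfl | hX0
  · exact zero_le
  have hp := hpq.pos
  have hq := hpq.symm.pos
  have hsum : 1 / p + 1 / q = 1 := by simpa using hpq.inv_add_inv_eq_one
  have hXq0 : X ^ (1 / q) ≠ 0 := by simp [hX0, hX]
  have hXq : X ^ (1 / q) ≠ ∞ := ENNReal.rpow_ne_top_of_nonneg (by positivity) hX
  have h1 : X ^ (1 / p) ≤ A ^ (1 / p) * K ^ (1 / q) := by
    rw [← ENNReal.mul_le_mul_iff_left hXq0 hXq, ← ENNReal.rpow_add _ _ hX0 hX, hsum,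
      ENNReal.rpow_one, mul_assoc, ← ENNReal.mul_rpow_of_nonneg _ _ (by positivity)]
    exact h
  have h2 := ENNReal.rpow_le_rpow h1 hp.le
  rw [ENNReal.mul_rpow_of_nonneg _ _ hp.le, ← ENNReal.rpow_mul, ← ENNReal.rpow_mul,
    ← ENNReal.rpow_mul, one_div_mul_cancel hp.ne', ENNReal.rpow_one, ENNReal.rpow_one,
    show 1 / q * p = p - 1 by
      rw [show 1 / q = 1 - 1 / p by linarith]
      field_simp, mul_comm] at h2
  exact h2

lemma lintegral_rpow_squareBeurling_le_dual {p q : ℝ} (hpq : p.HolderConjugate q) (hp : 2 < p)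
    {ε : ℝ} (hε : 0 < ε) {K : ℝ≥0∞} (hK : ∀ g : ℂ → ℂ, Continuous g →
      ∫⁻ z in unitSquare, ENNReal.ofReal (‖squareBeurling ε g z‖ ^ q) ≤
        K * ∫⁻ z in unitSquare, ENNReal.ofReal (‖g z‖ ^ q))
    {f : ℂ → ℂ} (hf : Continuous f) :
    ∫⁻ z in unitSquare, ENNReal.ofReal (‖squareBeurling ε f z‖ ^ p) ≤
      K ^ (p - 1) * ∫⁻ z in unitSquare, ENNReal.ofReal (‖f z‖ ^ p) := by
  set h := squareBeurling ε f with hdef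
  have hh : Continuous h := continuous_squareBeurling hε hf
  set g : ℂ → ℂ := fun z => (starRingEnd ℂ) (h z) * ((‖h z‖ ^ (p - 2) : ℝ) : ℂ)
  have hg : Continuous g := by
    refine (Complex.continuous_conj.comp hh).mul (Complex.continuous_ofReal.comp ?_)
    exact hh.norm.rpow_const fun z => Or.inr (by linarith)
  have hp0 := hpq.pos
  have hq0 := hpq.symm.pos
  have hpow : Continuous fun z => ‖h z‖ ^ p := hh.norm.rpow_const fun z => Or.inr hp0.le
  have hgq : ∀ z, ‖g z‖ ^ q = ‖h z‖ ^ p := fun z => by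
    have e : ‖g z‖ = ‖h z‖ ^ (p - 1) := by
      rw [norm_mul, RCLike.norm_conj, Complex.norm_real, Real.norm_of_nonneg (by positivity)]
      rcases (norm_nonneg (h z)).eq_or_lt with h0 | h0
      · rw [← h0, Real.zero_rpow (by linarith), zero_mul, Real.zero_rpow (by linarith)]
      · rw [show p - 1 = 1 + (p - 2) by ring, Real.rpow_add h0, Real.rpow_one]
    rw [e, ← Real.rpow_mul (norm_nonneg _), hpq.sub_one_mul_conj]
  have hhg : ∀ z, h z * g z = ((‖h z‖ ^ p : ℝ) : ℂ) := fun z => by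
    simp only [g]
    rw [← mul_assoc, Complex.mul_conj', ← Complex.ofReal_pow, ← Complex.ofReal_mul,
      ← Real.rpow_two]
    rcases (norm_nonneg (h z)).eq_or_lt with h0 | h0
    · rw [← h0, Real.zero_rpow two_ne_zero, zero_mul, Real.zero_rpow hp0.ne']
    · rw [← Real.rpow_add h0, add_sub_cancel]
  have hpi : IntegrableOn (fun z => ‖h z‖ ^ p) unitSquare := hpow.integrableOn_hoSquare _ _
  have hX : ∫⁻ z in unitSquare, ENNReal.ofReal (‖h z‖ ^ p) ≠ ∞ := hpi.lintegral_lt_top.ne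
  refine le_rpow_mul_of_le_rpow_mul_rpow hpq hX ?_
  have hr : ∀ (u : ℂ) {r : ℝ}, 0 < r → ENNReal.ofReal (‖u‖ ^ r) = ‖u‖ₑ ^ r := fun u r hr => by
    rw [← ENNReal.ofReal_rpow_of_nonneg (norm_nonneg _) hr.le, ofReal_norm]
  have hgi := hK g hg
  simp only [hgq] at hgi
  calc ∫⁻ z in unitSquare, ENNReal.ofReal (‖h z‖ ^ p)
      = ‖∫ z in unitSquare, h z * g z‖ₑ := by
        simp only [hhg]
        rw [integral_complex_ofReal, ← ofReal_integral_eq_lintegral_ofReal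
          hpi (Filter.Eventually.of_forall fun z => by positivity),
          ← ofReal_norm, Complex.norm_real, Real.norm_of_nonneg
            (integral_nonneg fun z => by positivity)]
    _ = ‖∫ w in unitSquare, f w * squareBeurling ε g w‖ₑ := by
        rw [hdef, setIntegral_squareBeurling_mul hε hf hg]
    _ ≤ ∫⁻ w in unitSquare, ‖f w‖ₑ * ‖squareBeurling ε g w‖ₑ := by
        refine (enorm_integral_le_lintegral_enorm _).trans_eq ?_
        simp only [enorm_mul]
    _ ≤ (∫⁻ w in unitSquare, ‖f w‖ₑ ^ p) ^ (1 / p) *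
          (∫⁻ w in unitSquare, ‖squareBeurling ε g w‖ₑ ^ q) ^ (1 / q) :=
        ENNReal.lintegral_mul_le_Lp_mul_Lq _ hpq hf.measurable.enorm.aemeasurable
          (continuous_squareBeurling hε hg).measurable.enorm.aemeasurable
    _ ≤ _ := by
        simp only [hr _ hp0, hr _ hq0] at hgi ⊢
        gcongr

/-- The regularised Beurling transforms are bounded on `L^p` of the square, uniformly in the
regularisation parameter. -/
lemma exists_lintegral_rpow_squareBeurling_le {p : ℝ} (hp : 1 < p) :
    ∃ K : ℝ≥0∞, K ≠ ∞ ∧ ∀ ε : ℝ, 0 < ε → ∀ f : ℂ → ℂ, Continuous f →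
      ∫⁻ z in unitSquare, ENNReal.ofReal (‖squareBeurling ε f z‖ ^ p) ≤
        K * ∫⁻ z in unitSquare, ENNReal.ofReal (‖f z‖ ^ p) := by
  rcases lt_trichotomy p 2 with h | rfl | h
  · exact ⟨strongConst p, strongConst_ne_top p, fun ε hε f hf =>
      lintegral_rpow_squareBeurling_le_of_lt_two hp h hε hf⟩
  · exact ⟨_, ENNReal.pow_ne_top lintegral_regDelta_one_ne_top, fun ε hε f hf =>
      lintegral_rpow_two_squareBeurling_le hε hf⟩
  · have hpq := Real.HolderConjugate.conjExponent hp
    have hq2 : p.conjExponent < 2 := by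
      rw [Real.conjExponent, div_lt_iff₀ (by linarith)]
      linarith
    exact ⟨_, ENNReal.rpow_ne_top_of_nonneg (by linarith) (strongConst_ne_top p.conjExponent),
      fun ε hε f hf => lintegral_rpow_squareBeurling_le_dual hpq h hε (fun g hg =>
        lintegral_rpow_squareBeurling_le_of_lt_two hpq.symm.lt hq2 hε hg) hf⟩

lemma ball_subset_unitSquare : Metric.ball (0 : ℂ) 1 ⊆ unitSquare := by
  intro z hz
  have h := mem_ball_zero_iff.mp hz
  have h1 := abs_lt.mp ((Complex.abs_re_le_norm z).trans_lt h)
  have h2 := abs_lt.mp ((Complex.abs_im_le_norm z).trans_lt h)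
  rw [unitSquare, mem_hoSquare]
  simp
  constructor <;> constructor <;> linarith

lemma locallyIntegrable_inv : LocallyIntegrable (fun z : ℂ => z⁻¹) := by
  refine locallyIntegrable_of_norm_le_rpow (C := 1) (α := 1)
    (by rw [Complex.finrank_real_complex]; norm_num)
    (by rw [Complex.finrank_real_complex]; norm_num)
    (Filter.Eventually.of_forall fun z => ?_) measurable_inv.aestronglyMeasurable
  rw [norm_inv, one_mul, Real.rpow_neg_one]

/-- The operator `∂̄g = ½(∂g/∂x + i ∂g/∂y)`. -/
noncomputable def dbarop (g : ℂ → ℂ) (z : ℂ) : ℂ :=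
  (1 / 2 : ℂ) * (fderiv ℝ g z 1 + Complex.I * fderiv ℝ g z Complex.I)

lemma hasFDerivAt_wirtinger {f : ℂ → ℂ} {z : ℂ} (hf : DifferentiableAt ℝ f z) :
    HasFDerivAt f (wirtinger (dop f z) (dbarop f z)) z := by
  refine hf.hasFDerivAt.congr_fderiv ?_
  ext e
  have he : fderiv ℝ f z e = e.re * fderiv ℝ f z 1 + e.im * fderiv ℝ f z Complex.I := by
    conv_lhs => rw [show e = e.re • (1 : ℂ) + e.im • Complex.I by simp]
    rw [map_add, map_smul, map_smul, Complex.real_smul, Complex.real_smul]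
  have hc : (starRingEnd ℂ) e = e.re - e.im * Complex.I := by
    apply Complex.ext <;> simp
  rw [wirtinger_apply, he, hc, dop, dbarop]
  linear_combination (e.im * fderiv ℝ f z Complex.I : ℂ) * Complex.I_sq +
    1 / 2 * (fderiv ℝ f z 1 - Complex.I * fderiv ℝ f z Complex.I) * Complex.re_add_im e

section smooth

variable {f : ℂ → ℂ}

lemma continuous_dop (hf : ContDiff ℝ 1 f) : Continuous (dop f) := by
  have h := hf.continuous_fderiv one_ne_zero
  unfold dop
  fun_prop

lemma continuous_dbarop (hf : ContDiff ℝ 1 f) : Continuous (dbarop f) := by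
  have h := hf.continuous_fderiv one_ne_zero
  unfold dbarop
  fun_prop

lemma HasCompactSupport.dop (hs : HasCompactSupport f) : HasCompactSupport (dop f) :=
  (hs.fderiv ℝ).mono' fun z hz => subset_tsupport _ fun h => hz (by simp [_root_.dop, h])

lemma HasCompactSupport.dbarop (hs : HasCompactSupport f) : HasCompactSupport (dbarop f) :=
  (hs.fderiv ℝ).mono' fun z hz => subset_tsupport _ fun h => hz (by simp [_root_.dbarop, h])

lemma kernelConv_regCauchy_dop (hf : ContDiff ℝ 1 f) (hs : HasCompactSupport f) {ε : ℝ}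
    (hε : 0 < ε) (z : ℂ) :
    kernelConv (regCauchy ε) (dop f) z = kernelConv (regBeurling ε) f z := by
  have hC : Continuous fun w => regCauchy ε (w - z) :=
    (continuous_regCauchy hε).comp (continuous_sub_right z)
  have hB : Continuous fun w => regBeurling ε (w - z) :=
    (continuous_regBeurling hε).comp (continuous_sub_right z)
  have hD : Continuous fun w => regDelta ε (w - z) :=
    (continuous_regDelta hε).comp (continuous_sub_right z)
  have hfc := hf.continuous
  have i1 : Integrable fun w => f w * regBeurling ε (w - z) :=
    (hfc.mul hB).integrable_of_hasCompactSupport hs.mul_right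
  have i2 : Integrable fun w => dop f w * regCauchy ε (w - z) :=
    ((continuous_dop hf).mul hC).integrable_of_hasCompactSupport hs.dop.mul_right
  have i3 : Integrable fun w => f w * regDelta ε (w - z) :=
    (hfc.mul hD).integrable_of_hasCompactSupport hs.mul_right
  have i4 : Integrable fun w => dbarop f w * regCauchy ε (w - z) :=
    ((continuous_dbarop hf).mul hC).integrable_of_hasCompactSupport hs.dbarop.mul_right
  have h := (integral_wirtinger_eq_zero (F := fun w => f w * regCauchy ε (w - z))
    (fun w => hasFDerivAt_wirtinger_mul
      (hasFDerivAt_wirtinger (hf.differentiable one_ne_zero w))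
      (hasFDerivAt_wirtinger_comp_sub z (hasFDerivAt_regCauchy hε (w - z))))
    ((hfc.mul hC).integrable_of_hasCompactSupport hs.mul_right) (i1.add i2) (i3.add i4)).1
  rw [integral_add i1 i2] at h
  have e1 : kernelConv (regBeurling ε) f z = ∫ w, f w * regBeurling ε (w - z) := by
    rw [kernelConv]
    congr 1
    ext w
    rw [← regBeurling_neg, neg_sub, mul_comm]
  have e2 : kernelConv (regCauchy ε) (dop f) z = -∫ w, dop f w * regCauchy ε (w - z) := by
    rw [kernelConv, ← integral_neg]
    congr 1
    ext w
    have : regCauchy ε (z - w) = -regCauchy ε (w - z) := by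
      rw [← neg_sub w z]
      simp only [regCauchy, map_neg, mul_neg, neg_mul, neg_neg]
    rw [this]
    ring
  rw [e1, e2]
  linear_combination -h

lemma tendsto_regCauchy (z : ℂ) :
    Filter.Tendsto (fun ε => regCauchy ε z) (nhds 0) (nhds z⁻¹) := by
  rcases eq_or_ne z 0 with rfl | hz
  · simp [regCauchy]
  have h0 : z * (starRingEnd ℂ) z ≠ 0 := mul_ne_zero hz (by simpa using hz)
  have h : ContinuousAt (fun ε : ℝ => regCauchy ε z) 0 := by
    unfold regCauchy
    refine continuousAt_const.mul (ContinuousAt.inv₀ (by fun_prop) (by simpa using hz))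
  have e : regCauchy 0 z = z⁻¹ := by
    have : (starRingEnd ℂ) z ≠ 0 := by simpa using hz
    simp only [regCauchy, Complex.ofReal_zero, add_zero]
    field_simp
  rw [← e]
  exact h

lemma integrable_inv_mul_comp_sub {u : ℂ → ℂ} (hu : Continuous u) (hs : HasCompactSupport u)
    (z : ℂ) : Integrable fun w => (z - w)⁻¹ * u w := by
  have h := hs.convolutionExists_right (ContinuousLinearMap.mul ℝ ℂ) locallyIntegrable_inv hu z
  have h' := h.integrable.comp_sub_left z
  simpa using h'

lemma tendsto_kernelConv_regCauchy {u : ℂ → ℂ} (hu : Continuous u) (hs : HasCompactSupport u)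
    {e : ℕ → ℝ} (he : ∀ n, 0 < e n) (hlim : Filter.Tendsto e Filter.atTop (nhds 0)) (z : ℂ) :
    Filter.Tendsto (fun n => kernelConv (regCauchy (e n)) u z) Filter.atTop
      (nhds (∫ w, (z - w)⁻¹ * u w)) := by
  refine tendsto_integral_of_dominated_convergence (fun w => ‖(z - w)⁻¹ * u w‖)
    (fun n => ?_) (integrable_inv_mul_comp_sub hu hs z).norm
    (fun n => Filter.Eventually.of_forall fun w => ?_)
    (Filter.Eventually.of_forall fun w => ?_)
  · have := continuous_regCauchy (he n)
    exact (by fun_prop : Continuous fun w => regCauchy (e n) (z - w) * u w).aestronglyMeasurable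
  · rw [norm_mul, norm_mul, norm_inv]
    exact mul_le_mul_of_nonneg_right (norm_regCauchy_le (he n) _) (norm_nonneg _)
  · exact ((tendsto_regCauchy (z - w)).comp hlim).mul_const _

lemma cauchyGreen_eq_convolution (hD : tsupport f ⊆ Metric.ball (0 : ℂ) 1) (z : ℂ) :
    cauchyGreen f z = (1 / (Real.pi : ℂ)) *
      convolution (fun z : ℂ => z⁻¹) f (ContinuousLinearMap.mul ℝ ℂ) volume z := by
  have e : ∫ w in Metric.ball (0 : ℂ) 1, f w / (w - z) = ∫ w, f w / (w - z) :=
    setIntegral_eq_integral_of_forall_compl_eq_zero fun w hw => by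
      rw [image_eq_zero_of_notMem_tsupport fun h => hw (hD h), zero_div]
  rw [cauchyGreen, e, ← integral_sub_left_eq_self _ _ z, convolution, neg_mul, ← mul_neg,
    ← integral_neg]
  congr 2
  ext w
  rw [sub_sub_cancel_left, div_neg, neg_neg, ContinuousLinearMap.mul_apply', div_eq_inv_mul]

lemma dop_cauchyGreen (hf : ContDiff ℝ 1 f) (hs : HasCompactSupport f)
    (hD : tsupport f ⊆ Metric.ball (0 : ℂ) 1) (z : ℂ) :
    dop (cauchyGreen f) z = (1 / (Real.pi : ℂ)) * ∫ w, (z - w)⁻¹ * dop f w := by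
  have h := (hs.hasFDerivAt_convolution_right (ContinuousLinearMap.mul ℝ ℂ)
    locallyIntegrable_inv hf z).const_mul (1 / (Real.pi : ℂ))
  have hi := ((hs.fderiv ℝ).convolutionExists_right
    ((ContinuousLinearMap.mul ℝ ℂ).precompR ℂ) locallyIntegrable_inv
    (hf.continuous_fderiv one_ne_zero) z).integrable
  have he : ∀ v, convolution (fun z : ℂ => z⁻¹) (fderiv ℝ f)
      ((ContinuousLinearMap.mul ℝ ℂ).precompR ℂ) volume z v =
      ∫ w, w⁻¹ * fderiv ℝ f (z - w) v := fun v => by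
    rw [convolution, ContinuousLinearMap.integral_apply hi]
    rfl
  have hiv : ∀ v, Integrable fun w => w⁻¹ * fderiv ℝ f (z - w) v := fun v =>
    hi.apply_continuousLinearMap v
  rw [← integral_sub_left_eq_self _ _ z, funext (cauchyGreen_eq_convolution hD), dop, h.fderiv]
  simp only [smul_apply, he, sub_sub_cancel, smul_eq_mul]
  rw [mul_left_comm Complex.I, ← mul_sub, ← integral_const_mul, ← integral_sub (hiv _)
    ((hiv _).const_mul _), mul_left_comm, ← integral_const_mul]
  congr 2
  ext w
  rw [dop]
  ring

lemma tendsto_squareBeurling (hf : ContDiff ℝ 1 f) (hs : HasCompactSupport f)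
    (hD : tsupport f ⊆ Metric.ball (0 : ℂ) 1) {e : ℕ → ℝ} (he : ∀ n, 0 < e n)
    (hlim : Filter.Tendsto e Filter.atTop (nhds 0)) (z : ℂ) :
    Filter.Tendsto (fun n => (1 / (Real.pi : ℂ)) * squareBeurling (e n) f z) Filter.atTop
      (nhds (dop (cauchyGreen f) z)) := by
  rw [dop_cauchyGreen hf hs hD]
  refine ((tendsto_kernelConv_regCauchy (continuous_dop hf) hs.dop he hlim z).const_mul _).congr
    fun n => ?_
  rw [kernelConv_regCauchy_dop hf hs (he n), squareBeurling, Set.indicator_eq_self.mpr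
    ((subset_tsupport f).trans (hD.trans ball_subset_unitSquare))]

lemma lintegral_rpow_dop_cauchyGreen_le {p : ℝ} (hp : 0 < p) {K : ℝ≥0∞}
    (hK : ∀ ε : ℝ, 0 < ε → ∀ f : ℂ → ℂ, Continuous f →
      ∫⁻ z in unitSquare, ENNReal.ofReal (‖squareBeurling ε f z‖ ^ p) ≤
        K * ∫⁻ z in unitSquare, ENNReal.ofReal (‖f z‖ ^ p))
    (hf : ContDiff ℝ 1 f) (hs : HasCompactSupport f)
    (hD : tsupport f ⊆ Metric.ball (0 : ℂ) 1) :
    ∫⁻ z in Metric.ball (0 : ℂ) 1, ENNReal.ofReal (‖dop (cauchyGreen f) z‖ ^ p) ≤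
      K * ∫⁻ z in Metric.ball (0 : ℂ) 1, ENNReal.ofReal (‖f z‖ ^ p) := by
  set e : ℕ → ℝ := fun n => 1 / ((n : ℝ) + 1)
  have he : ∀ n, 0 < e n := fun n => Nat.one_div_pos_of_nat
  have hlim : Filter.Tendsto e Filter.atTop (nhds 0) := tendsto_one_div_add_atTop_nhds_zero_nat
  have hc : ∀ n, Continuous (squareBeurling (e n) f) := fun n =>
    continuous_squareBeurling (he n) hf.continuous
  have hpi : ∀ w : ℂ, ‖(1 / (Real.pi : ℂ)) * w‖ ≤ ‖w‖ := fun w => by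
    rw [norm_mul, norm_div, norm_one, Complex.norm_real, Real.norm_of_nonneg Real.pi_pos.le]
    exact mul_le_of_le_one_left (norm_nonneg _)
      ((div_le_one Real.pi_pos).mpr (by linarith [Real.pi_gt_three]))
  have hball : ∫⁻ z in unitSquare, ENNReal.ofReal (‖f z‖ ^ p) =
      ∫⁻ z in Metric.ball (0 : ℂ) 1, ENNReal.ofReal (‖f z‖ ^ p) := by
    have h0 : ∀ z ∉ Metric.ball (0 : ℂ) 1, ENNReal.ofReal (‖f z‖ ^ p) = 0 := fun z hz => by
      rw [image_eq_zero_of_notMem_tsupport fun h => hz (hD h), norm_zero,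
        Real.zero_rpow hp.ne', ENNReal.ofReal_zero]
    rw [← lintegral_indicator measurableSet_unitSquare,
      ← lintegral_indicator Metric.isOpen_ball.measurableSet, Set.indicator_eq_self.mpr fun z hz =>
        ball_subset_unitSquare (not_imp_comm.mp (h0 z) hz), Set.indicator_eq_self.mpr fun z hz =>
        not_imp_comm.mp (h0 z) hz]
  have hpt : ∀ z, Filter.Tendsto
      (fun n => ENNReal.ofReal (‖(1 / (Real.pi : ℂ)) * squareBeurling (e n) f z‖ ^ p))
      Filter.atTop (nhds (ENNReal.ofReal (‖dop (cauchyGreen f) z‖ ^ p))) := fun z =>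
    (ENNReal.continuous_ofReal.tendsto _).comp
      ((tendsto_squareBeurling hf hs hD he hlim z).norm.rpow_const (Or.inr hp.le))
  calc ∫⁻ z in Metric.ball (0 : ℂ) 1, ENNReal.ofReal (‖dop (cauchyGreen f) z‖ ^ p)
      = ∫⁻ z in Metric.ball (0 : ℂ) 1, Filter.liminf (fun n => ENNReal.ofReal
          (‖(1 / (Real.pi : ℂ)) * squareBeurling (e n) f z‖ ^ p)) Filter.atTop := by
        simp only [(hpt _).liminf_eq]
    _ ≤ Filter.liminf (fun n => ∫⁻ z in Metric.ball (0 : ℂ) 1, ENNReal.ofReal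
          (‖(1 / (Real.pi : ℂ)) * squareBeurling (e n) f z‖ ^ p)) Filter.atTop :=
        lintegral_liminf_le fun n => by
          have := hc n
          fun_prop
    _ ≤ K * ∫⁻ z in Metric.ball (0 : ℂ) 1, ENNReal.ofReal (‖f z‖ ^ p) := by
        refine Filter.liminf_le_of_le (by isBoundedDefault) fun b hb => ?_
        obtain ⟨n, hn⟩ := hb.exists
        refine hn.trans ?_
        rw [← hball]
        refine le_trans ?_ (hK (e n) (he n) f hf.continuous)
        refine (lintegral_mono fun z => ENNReal.ofReal_le_ofReal ?_).trans
          (lintegral_mono_set ball_subset_unitSquare)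
        exact Real.rpow_le_rpow (norm_nonneg _) (hpi _) hp.le

end smooth

/-- the Beurling transform `T = ∂ ∘ P` is bounded on
`L^p(D)` for every `1 < p < ∞`, stated on smooth compactly supported
densities. -/
theorem beurling_lp_bounded (p : ℝ) (hp : 1 < p) :
    ∃ C > 0, ∀ f : ℂ → ℂ, ContDiff ℝ 1 f → HasCompactSupport f →
      tsupport f ⊆ Metric.ball (0 : ℂ) 1 →
      (∫ z in Metric.ball (0 : ℂ) 1, ‖dop (cauchyGreen f) z‖ ^ p) ^ (1 / p) ≤
        C * (∫ z in Metric.ball (0 : ℂ) 1, ‖f z‖ ^ p) ^ (1 / p) := by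
  have hp0 : 0 < p := by linarith
  obtain ⟨K, hK, h⟩ := exists_lintegral_rpow_squareBeurling_le hp
  refine ⟨K.toReal ^ (1 / p) + 1, by positivity, fun f hf hs hD => ?_⟩
  have hY : 0 ≤ ∫ z in Metric.ball (0 : ℂ) 1, ‖f z‖ ^ p :=
    integral_nonneg fun z => by positivity
  have hfi : IntegrableOn (fun z => ‖f z‖ ^ p) (Metric.ball (0 : ℂ) 1) :=
    ((hf.continuous.norm.rpow_const fun z => Or.inr hp0.le).continuousOn.integrableOn_compact
      (isCompact_closedBall (0 : ℂ) 1)).mono_set Metric.ball_subset_closedBall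
  have key : ∫ z in Metric.ball (0 : ℂ) 1, ‖dop (cauchyGreen f) z‖ ^ p ≤
      K.toReal * ∫ z in Metric.ball (0 : ℂ) 1, ‖f z‖ ^ p := by
    rw [← ENNReal.ofReal_le_ofReal_iff (by positivity), ENNReal.ofReal_mul ENNReal.toReal_nonneg,
      ENNReal.ofReal_toReal hK, ofReal_integral_eq_lintegral_ofReal hfi
        (Filter.Eventually.of_forall fun z => by positivity)]
    refine le_trans ?_ (lintegral_rpow_dop_cauchyGreen_le hp0 h hf hs hD)
    refine (Real.ofReal_le_enorm _).trans ((enorm_integral_le_lintegral_enorm _).trans_eq ?_)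
    refine lintegral_congr fun z => ?_
    rw [Real.enorm_of_nonneg (by positivity)]
  calc _ ≤ (K.toReal * ∫ z in Metric.ball (0 : ℂ) 1, ‖f z‖ ^ p) ^ (1 / p) :=
        Real.rpow_le_rpow (integral_nonneg fun z => by positivity) key (by positivity)
    _ = K.toReal ^ (1 / p) * (∫ z in Metric.ball (0 : ℂ) 1, ‖f z‖ ^ p) ^ (1 / p) :=
        Real.mul_rpow ENNReal.toReal_nonneg hY
    _ ≤ _ := by
        gcongr
        linarith
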